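/- Let x : ℝ → ℝ³ be a C^∞ arclength-parametrized curve, s₀ with κ > 0 and ν = √(κ'² + κ²τ²) > 0 on a neighborhood of s₀. Let e be the local inverse at 0 of ω(ε) = ∫_{s₀}^{s₀+ε} ν(s)^{1/2} ds. Set x₁ = x(s₀+e(−2w)), x₂ = x(s₀+e(−w)), x₃ = x(s₀), x₄ = x(s₀+e(w)). Then, as w → 0 (w ≠ 0), tLast(x₁,x₂,x₃) · tMid(x₂,x₃,x₄) = 1 − w⁴/8 + P·w⁶ + O(w⁷), where P = [2κτκ'²(20κ'τ' − 19τκ'') + 2κ³τ³(5κ'τ' − 4τκ'') + κ'²(28τ²κ'² − 5κ''² + 4κ'κ''') + κ²(19τ⁴κ'² − 4κ'⁴ + 10κ'²τ'² + 2τκ'(2κ'τ'' − 15τ'κ'') + 2τ²(5κ''² + 2κ'κ''')) + κ⁴τ²(6τ⁴ − 8κ'² − 5τ'² + 4ττ'') − 4κ⁶τ⁴] / (192·(κ²τ² + κ'²)^{5/2}), all quantities evaluated at s₀. -/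

import Mathlib

open scoped RealInnerProductSpace Topology
open Asymptotics

noncomputable section

abbrev E3 := EuclideanSpace ℝ (Fin 3)

/-- Cross product on `ℝ³`. -/
def cross3 (u v : E3) : E3 :=
  (WithLp.equiv 2 (Fin 3 → ℝ)).symm
    ![u 1 * v 2 - u 2 * v 1, u 2 * v 0 - u 0 * v 2, u 0 * v 1 - u 1 * v 0]

/-- Curvature of an arclength-parametrized curve. -/
def curv (x : ℝ → E3) (s : ℝ) : ℝ := ‖iteratedDeriv 2 x s‖

/-- Torsion of an arclength-parametrized curve (where `curv x s > 0`). -/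
def tors (x : ℝ → E3) (s : ℝ) : ℝ :=
  ⟪cross3 (deriv x s) (iteratedDeriv 2 x s), iteratedDeriv 3 x s⟫ / curv x s ^ 2

/-- `ν = √(κ'² + κ²τ²)`. -/
def nu (x : ℝ → E3) (s : ℝ) : ℝ :=
  Real.sqrt (deriv (curv x) s ^ 2 + curv x s ^ 2 * tors x s ^ 2)

/-- Oriented unit tangent vector of the circumcircle of `(a, m, b)` at `a`. -/
def tFirst (a m b : E3) : E3 :=
  (1 / dist m b) • ((dist a b / dist a m) • (m - a) + (dist a m / dist a b) • (a - b))

/-- Oriented unit tangent vector of the circumcircle of `(a, m, b)` at `m`. -/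
def tMid (a m b : E3) : E3 :=
  (1 / dist a b) • ((dist a m / dist m b) • (b - m) + (dist m b / dist a m) • (m - a))

/-- Oriented unit tangent vector of the circumcircle of `(a, m, b)` at `b`. -/
def tLast (a m b : E3) : E3 :=
  (1 / dist a m) • ((dist m b / dist a b) • (a - b) + (dist a b / dist m b) • (b - m))

/-- `f` agrees with the quadratic polynomial `a + b w + c w²` up to `O(w³)` as `w → 0`, `w ≠ 0`. -/
def QuadJet (f : ℝ → ℝ) (a b c : ℝ) : Prop :=
  (fun w => f w - (a + b * w + c * w ^ 2)) =O[𝓝[≠] (0 : ℝ)] fun w => w ^ 3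

theorem tendsto_id_punctured : Filter.Tendsto (fun w : ℝ => w) (𝓝[≠] 0) (𝓝 0) :=
  Filter.tendsto_id.mono_left nhdsWithin_le_nhds

theorem isBigO_one_of_continuous {p : ℝ → ℝ} (hp : Continuous p) :
    p =O[𝓝[≠] (0 : ℝ)] fun _ => (1 : ℝ) :=
  ((hp.tendsto 0).mono_left nhdsWithin_le_nhds).isBigO_one ℝ

namespace QuadJet

variable {f g : ℝ → ℝ} {a b c a' b' c' : ℝ}

theorem congr_coeff (h : QuadJet f a b c) (ha : a = a') (hb : b = b') (hc : c = c') :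
    QuadJet f a' b' c' := by
  subst ha hb hc; exact h

theorem congr_fun (h : QuadJet f a b c) (hfg : ∀ᶠ w in 𝓝[≠] (0 : ℝ), f w = g w) :
    QuadJet g a b c :=
  h.congr' (hfg.mono fun w hw => by simp only [hw]) Filter.EventuallyEq.rfl

theorem const (a : ℝ) : QuadJet (fun _ => a) a 0 0 := by
  simpa [QuadJet] using isBigO_zero _ _

theorem id : QuadJet (fun w => w) 0 1 0 := by
  simpa [QuadJet] using isBigO_zero _ _

theorem add (hf : QuadJet f a b c) (hg : QuadJet g a' b' c') :
    QuadJet (fun w => f w + g w) (a + a') (b + b') (c + c') :=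
  (IsBigO.add hf hg).congr_left fun w => by ring

theorem tendsto (hf : QuadJet f a b c) : Filter.Tendsto f (𝓝[≠] 0) (𝓝 a) := by
  have h1 : Filter.Tendsto (fun w : ℝ => w ^ 3) (𝓝[≠] 0) (𝓝 0) := by
    simpa using tendsto_id_punctured.pow 3
  have h2 : Filter.Tendsto (fun w : ℝ => a + b * w + c * w ^ 2) (𝓝[≠] 0) (𝓝 a) := by
    have : Continuous fun w : ℝ => a + b * w + c * w ^ 2 := by fun_prop
    simpa using (this.tendsto 0).mono_left nhdsWithin_le_nhds
  simpa using (hf.trans_tendsto h1).add h2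

theorem isBigO_one (hf : QuadJet f a b c) : f =O[𝓝[≠] (0 : ℝ)] fun _ => (1 : ℝ) :=
  hf.tendsto.isBigO_one ℝ

theorem mul (hf : QuadJet f a b c) (hg : QuadJet g a' b' c') :
    QuadJet (fun w => f w * g w) (a * a') (a * b' + b * a') (a * c' + b * b' + c * a') := by
  have h1 : (fun w => (f w - (a + b * w + c * w ^ 2)) * g w) =O[𝓝[≠] (0 : ℝ)] fun w => w ^ 3 := by
    simpa using IsBigO.mul hf hg.isBigO_one
  have h2 : (fun w => (a + b * w + c * w ^ 2) * (g w - (a' + b' * w + c' * w ^ 2)))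
      =O[𝓝[≠] (0 : ℝ)] fun w => w ^ 3 := by
    simpa using IsBigO.mul (isBigO_one_of_continuous
      (p := fun w => a + b * w + c * w ^ 2) (by fun_prop)) hg
  have h3 : (fun w : ℝ => w ^ 3 * (b * c' + c * b' + c * c' * w))
      =O[𝓝[≠] (0 : ℝ)] fun w => w ^ 3 := by
    simpa using IsBigO.mul (isBigO_refl (fun w : ℝ => w ^ 3) _)
      (isBigO_one_of_continuous (p := fun w => b * c' + c * b' + c * c' * w) (by fun_prop))
  exact ((h1.add h2).add h3).congr_left fun w => by ring

theorem const_mul (k : ℝ) (hf : QuadJet f a b c) :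
    QuadJet (fun w => k * f w) (k * a) (k * b) (k * c) :=
  ((const k).mul hf).congr_coeff (by ring) (by ring) (by ring)

theorem sub (hf : QuadJet f a b c) (hg : QuadJet g a' b' c') :
    QuadJet (fun w => f w - g w) (a - a') (b - b') (c - c') :=
  (IsBigO.sub hf hg).congr_left fun w => by ring

theorem inv (hf : QuadJet f a b c) (ha : a ≠ 0) :
    QuadJet (fun w => (f w)⁻¹) a⁻¹ (-b * a⁻¹ ^ 2) (b ^ 2 * a⁻¹ ^ 3 - c * a⁻¹ ^ 2) := by
  set q : ℝ → ℝ := fun w => a⁻¹ + (-b * a⁻¹ ^ 2) * w + (b ^ 2 * a⁻¹ ^ 3 - c * a⁻¹ ^ 2) * w ^ 2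
    with hq
  have hqj : QuadJet q a⁻¹ (-b * a⁻¹ ^ 2) (b ^ 2 * a⁻¹ ^ 3 - c * a⁻¹ ^ 2) := by
    simpa [QuadJet, hq] using isBigO_zero _ _
  have h1 : QuadJet (fun w => 1 - f w * q w) 0 0 0 :=
    ((const 1).sub (hf.mul hqj)).congr_coeff (by field_simp; ring) (by field_simp; ring)
      (by field_simp; ring)
  have h2 : (fun w => (f w)⁻¹) =O[𝓝[≠] (0 : ℝ)] fun _ => (1 : ℝ) :=
    (hf.tendsto.inv₀ ha).isBigO_one ℝ
  have h3 := IsBigO.mul h2 h1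
  refine IsBigO.congr' h3 ?_ (by simp)
  filter_upwards [hf.tendsto.eventually_ne ha] with w hw
  simp only [hq]
  field_simp
  ring

theorem comp_const_mul (hf : QuadJet f a b c) {k : ℝ} (hk : k ≠ 0) :
    QuadJet (fun w => f (k * w)) a (k * b) (k ^ 2 * c) := by
  have ht : Filter.Tendsto (fun w : ℝ => k * w) (𝓝[≠] 0) (𝓝[≠] 0) := by
    refine tendsto_nhdsWithin_iff.2 ⟨by simpa using tendsto_id_punctured.const_mul k, ?_⟩
    filter_upwards [self_mem_nhdsWithin] with w hw
    exact mul_ne_zero hk hw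
  have h := IsBigO.comp_tendsto hf ht
  have h2 : ((fun w : ℝ => w ^ 3) ∘ fun w => k * w) =O[𝓝[≠] (0 : ℝ)] fun w => w ^ 3 := by
    refine (isBigO_const_mul_self (k ^ 3) (fun w : ℝ => w ^ 3) _).congr_left fun w => ?_
    simp [mul_pow]
  exact (h.trans h2).congr_left fun w => by simp only [Function.comp_apply]; ring

/-- Composition with a reparametrization `w ↦ w u(w)` fixing the origin. -/
theorem comp_id_mul (hf : QuadJet f a b c) {u : ℝ → ℝ} {α β γ : ℝ} (hu : QuadJet u α β γ)
    (hα : α ≠ 0) :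
    QuadJet (fun w => f (w * u w)) a (b * α) (b * β + c * α ^ 2) := by
  have hj : QuadJet (fun w => w * u w) 0 α β :=
    (QuadJet.id.mul hu).congr_coeff (by ring) (by ring) (by ring)
  have ht : Filter.Tendsto (fun w : ℝ => w * u w) (𝓝[≠] 0) (𝓝[≠] 0) := by
    refine tendsto_nhdsWithin_iff.2 ⟨hj.tendsto, ?_⟩
    filter_upwards [self_mem_nhdsWithin, hu.tendsto.eventually_ne hα] with w hw hw'
    exact mul_ne_zero hw hw'
  have h := IsBigO.comp_tendsto hf ht
  have h2 : ((fun w : ℝ => w ^ 3) ∘ fun w => w * u w) =O[𝓝[≠] (0 : ℝ)] fun w => w ^ 3 := by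
    have := IsBigO.mul (isBigO_refl (fun w : ℝ => w ^ 3) (𝓝[≠] 0)) (hu.isBigO_one.pow 3)
    refine (this.congr_left fun w => ?_).congr_right fun w => ?_
    · simp [mul_pow]
    · simp
  have h3 := ((const a).add (hj.const_mul b)).add ((hj.mul hj).const_mul c)
  have h4 : QuadJet (fun w => a + b * (w * u w) + c * (w * u w * (w * u w)))
      a (b * α) (b * β + c * α ^ 2) :=
    h3.congr_coeff (by ring) (by ring) (by ring)
  exact ((h.trans h2).add h4).congr_left fun w => by simp only [Function.comp_apply]; ring

end QuadJet

/-- Division of an asymptotic expansion by `w ^ k`. -/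
theorem quadJet_of_isBigO {F f : ℝ → ℝ} {a b c : ℝ} (k : ℕ)
    (h : (fun w => F w - w ^ k * (a + b * w + c * w ^ 2)) =O[𝓝[≠] (0 : ℝ)] fun w => w ^ (k + 3))
    (hF : ∀ᶠ w in 𝓝[≠] (0 : ℝ), F w = w ^ k * f w) : QuadJet f a b c := by
  have h1 := IsBigO.mul (isBigO_refl (fun w : ℝ => (w ^ k)⁻¹) (𝓝[≠] 0)) h
  refine IsBigO.congr' h1 ?_ ?_
  · filter_upwards [hF, self_mem_nhdsWithin] with w hw hw0
    have hw0 : w ≠ 0 := hw0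
    rw [hw]; field_simp
  · filter_upwards [self_mem_nhdsWithin] with w hw0
    have hw0 : w ≠ 0 := hw0
    rw [pow_add]; field_simp

/-- Integration of a `O`-bound. -/
theorem isBigO_pow_succ_of_hasDerivAt {E : Type*} [NormedAddCommGroup E] [NormedSpace ℝ E]
    {F F' : ℝ → E} {a : ℝ} {n : ℕ} (hF : ∀ᶠ s in 𝓝 a, HasDerivAt F (F' s) s) (h0 : F a = 0)
    (hF' : F' =O[𝓝 a] fun s => (s - a) ^ n) : F =O[𝓝 a] fun s => (s - a) ^ (n + 1) := by
  obtain ⟨C, hC⟩ := hF'.bound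
  obtain ⟨r, hr, hball⟩ := Metric.eventually_nhds_iff_ball.1 (hF.and hC)
  refine IsBigO.of_bound C ?_
  filter_upwards [Metric.ball_mem_nhds a hr] with s hs
  have hsub : Metric.closedBall a |s - a| ⊆ Metric.ball a r := fun t ht =>
    lt_of_le_of_lt (Metric.mem_closedBall.1 ht) (by simpa [Real.dist_eq] using hs)
  have hmv := (convex_closedBall a |s - a|).norm_image_sub_le_of_norm_hasDerivWithin_le
    (f := F) (f' := F') (C := C * |s - a| ^ n) (x := a) (y := s)
    (fun t ht => (hball t (hsub ht)).1.hasDerivWithinAt)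
    (fun t ht => by
      have hta : |t - a| ≤ |s - a| := by simpa [Real.dist_eq] using ht
      have h := (hball t (hsub ht)).2
      rw [norm_pow, Real.norm_eq_abs] at h
      rcases le_or_gt 0 C with hc | hc
      · exact h.trans (by gcongr)
      · have h0 : ‖F' t‖ = 0 := by
          refine le_antisymm (h.trans (mul_nonpos_of_nonpos_of_nonneg hc.le (by positivity)))
            (norm_nonneg _)
        have hsn := (hball s hs).2
        rw [norm_pow, Real.norm_eq_abs] at hsn
        rw [h0]; exact (norm_nonneg _).trans hsn)
    (by simp) (by simp [Real.dist_eq])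
  rw [h0, sub_zero] at hmv
  refine hmv.trans (le_of_eq ?_)
  rw [norm_pow, Real.norm_eq_abs, pow_succ]; ring

/-- Taylor formula along a chain of successive derivatives. -/
theorem taylor_isBigO_of_hasDerivAt {E : Type*} [NormedAddCommGroup E] [NormedSpace ℝ E]
    {a : ℝ} (n : ℕ) : ∀ F : ℕ → ℝ → E,
    (∀ k < n, ∀ᶠ s in 𝓝 a, HasDerivAt (F k) (F (k + 1) s) s) → DifferentiableAt ℝ (F n) a →
    (fun s => F 0 s - ∑ k ∈ Finset.range (n + 1), ((s - a) ^ k / (k.factorial : ℝ)) • F k a)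
      =O[𝓝 a] fun s => (s - a) ^ (n + 1) := by
  induction n with
  | zero =>
    intro F _ hd
    simpa using hd.isBigO_sub
  | succ n ih =>
    intro F hF hd
    have h := ih (fun k => F (k + 1)) (fun k hk => hF (k + 1) (by omega)) hd
    refine isBigO_pow_succ_of_hasDerivAt ?_ ?_ h
    · filter_upwards [hF 0 (by omega)] with s hs
      have hsum : HasDerivAt (fun s => ∑ k ∈ Finset.range (n + 1 + 1),
          ((s - a) ^ k / (k.factorial : ℝ)) • F k a)
          (∑ k ∈ Finset.range (n + 1 + 1),
            ((k : ℝ) * (s - a) ^ (k - 1) / (k.factorial : ℝ)) • F k a) s := by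
        refine HasDerivAt.fun_sum fun k _ => ?_
        have := ((((hasDerivAt_id s).sub_const a).pow k).div_const (k.factorial : ℝ)).smul_const
          (F k a)
        simpa using this
      convert hs.fun_sub hsum using 1
      rw [Finset.sum_range_succ' _ (n + 1)]
      simp only [Nat.cast_zero, zero_mul, zero_div, zero_smul, add_zero, Nat.add_sub_cancel]
      congr 1
      refine Finset.sum_congr rfl fun k _ => ?_
      congr 1
      rw [Nat.factorial_succ]
      push_cast
      field_simp
    · rw [Finset.sum_range_succ']
      simp

/-- Inversion of a vector in the unit sphere. -/
def sphereInv (v : E3) : E3 := (‖v‖ ^ 2)⁻¹ • v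

theorem norm_sphereInv_sub {p r : E3} (hp : p ≠ 0) (hr : r ≠ 0) :
    ‖sphereInv p - sphereInv r‖ = ‖p - r‖ / (‖p‖ * ‖r‖) := by
  have h := dist_div_norm_sq_smul hp hr 1
  simp only [one_div, inv_pow, dist_eq_norm, one_pow] at h
  rw [sphereInv, sphereInv, h]
  ring

/-- The tangent vector at the origin of the circle through `p`, `r` and the origin is the
normalized difference of the inverted points. -/
theorem circleTangent_eq {p r : E3} (hp : p ≠ 0) (hr : r ≠ 0) :
    (1 / ‖p - r‖) • ((‖r‖ / ‖p‖) • p - (‖p‖ / ‖r‖) • r) =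
      ‖sphereInv p - sphereInv r‖⁻¹ • (sphereInv p - sphereInv r) := by
  have hp' := norm_ne_zero_iff.2 hp
  have hr' := norm_ne_zero_iff.2 hr
  rw [norm_sphereInv_sub hp hr, sphereInv, sphereInv, smul_sub, smul_sub, smul_smul, smul_smul,
    smul_smul, smul_smul, inv_div]
  congr 2 <;> field_simp

theorem inner_tLast_tMid {a m b d : E3} (ha : a ≠ b) (hm : m ≠ b) (hd : d ≠ b) :
    ⟪tLast a m b, tMid m b d⟫ =
      ⟪sphereInv (a - b) - sphereInv (m - b), sphereInv (d - b) - sphereInv (m - b)⟫ /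
        (‖sphereInv (a - b) - sphereInv (m - b)‖ * ‖sphereInv (d - b) - sphereInv (m - b)‖) := by
  have h1 : tLast a m b = ‖sphereInv (a - b) - sphereInv (m - b)‖⁻¹ •
      (sphereInv (a - b) - sphereInv (m - b)) := by
    rw [← circleTangent_eq (sub_ne_zero.2 ha) (sub_ne_zero.2 hm), tLast, dist_eq_norm,
      dist_eq_norm, dist_eq_norm, sub_sub_sub_cancel_right]
    congr 1
    rw [← neg_sub m b, smul_neg, ← sub_eq_add_neg]
  have h2 : tMid m b d = ‖sphereInv (d - b) - sphereInv (m - b)‖⁻¹ •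
      (sphereInv (d - b) - sphereInv (m - b)) := by
    rw [← circleTangent_eq (sub_ne_zero.2 hd) (sub_ne_zero.2 hm), tMid, dist_comm m d,
      dist_comm b d, dist_eq_norm, dist_eq_norm, dist_eq_norm, sub_sub_sub_cancel_right]
    congr 1
    rw [← neg_sub m b, smul_neg, ← sub_eq_add_neg]
  rw [h1, h2, real_inner_smul_left, real_inner_smul_right]
  rw [div_eq_mul_inv, mul_inv]
  ring

/-- The cosine of a small angle whose squared sine has a prescribed expansion. -/
theorem cos_expansion {c S : ℝ → ℝ} {P : ℝ} (hS : QuadJet S (1 / 4) 0 (-2 * P))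
    (hc : ∀ᶠ w in 𝓝[≠] (0 : ℝ), 0 ≤ c w ∧ 1 - c w ^ 2 = w ^ 4 * S w) :
    (fun w => c w - (1 - w ^ 4 / 8 + P * w ^ 6)) =O[𝓝[≠] (0 : ℝ)] fun w => w ^ 7 := by
  have h1 : (fun w => w ^ 4 * (S w - (1 / 4 + 0 * w + -2 * P * w ^ 2)))
      =O[𝓝[≠] (0 : ℝ)] fun w => w ^ 7 :=
    (IsBigO.mul (isBigO_refl (fun w : ℝ => w ^ 4) _) hS).congr_right fun w => by ring
  have h2 : (fun w => (1 - c w) ^ 2) =O[𝓝[≠] (0 : ℝ)] fun w => w ^ 7 := by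
    have h3 : (fun w => (w ^ 4 * S w) ^ 2) =O[𝓝[≠] (0 : ℝ)] fun w => w ^ 7 := by
      have := IsBigO.mul (isBigO_refl (fun w : ℝ => w ^ 7) (𝓝[≠] 0))
        ((isBigO_one_of_continuous continuous_id).mul (hS.isBigO_one.pow 2))
      simp only [one_pow, mul_one] at this
      exact this.congr_left fun w => by simp only [id_eq]; ring
    refine IsBigO.trans (IsBigO.of_bound 1 ?_) h3
    filter_upwards [hc] with w hw
    rw [one_mul, ← hw.2, norm_pow, norm_pow]
    have : ‖1 - c w ^ 2‖ = ‖1 - c w‖ * (1 + c w) := by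
      rw [show 1 - c w ^ 2 = (1 - c w) * (1 + c w) by ring, norm_mul, Real.norm_eq_abs (1 + c w),
        abs_of_nonneg (by linarith [hw.1])]
    rw [this]
    gcongr
    nlinarith [norm_nonneg (1 - c w), hw.1]
  refine IsBigO.congr' ((h1.const_mul_left (-1 / 2)).sub (h2.const_mul_left (1 / 2))) ?_
    Filter.EventuallyEq.rfl
  filter_upwards [hc] with w hw
  linear_combination (1 / 2) * hw.2

/-- Angle expansion for `2 q(-w) - q(-2w)` and `(q(w) + q(-w)) / 2` in terms of the
coordinates of `q` in an orthonormal basis. -/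
theorem angle_expansion (b : OrthonormalBasis (Fin 3) ℝ E3) {q : ℝ → E3} {H L : ℝ → ℝ}
    {q₀ q₁ q₂ h₀ h₁ h₂ l₀ l₁ l₂ u v P : ℝ} (hq₀ : q₀ ≠ 0)
    (hT : QuadJet (fun w => ⟪q w, b 0⟫) q₀ q₁ q₂)
    (hN : ∀ᶠ w in 𝓝[≠] (0 : ℝ), ⟪q w, b 1⟫ = u * w + w ^ 2 * H w)
    (hB : ∀ᶠ w in 𝓝[≠] (0 : ℝ), ⟪q w, b 2⟫ = v * w + w ^ 2 * L w)
    (hH : QuadJet H h₀ h₁ h₂) (hL : QuadJet L l₀ l₁ l₂)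
    (e₀ : 36 * (h₀ ^ 2 + l₀ ^ 2) = q₀ ^ 2) (e₁ : h₀ * h₁ + l₀ * l₁ = 0)
    (e₂ : 36 * (h₁ ^ 2 + l₁ ^ 2) + 90 * (h₀ * h₂ + l₀ * l₂) + q₂ * q₀ / 2 =
      -2 * P * q₀ ^ 2) :
    (fun w => ⟪(2 : ℝ) • q (-1 * w) - q (-2 * w), (1 / 2 : ℝ) • (q (1 * w) + q (-1 * w))⟫ /
        (‖(2 : ℝ) • q (-1 * w) - q (-2 * w)‖ * ‖(1 / 2 : ℝ) • (q (1 * w) + q (-1 * w))‖) -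
      (1 - w ^ 4 / 8 + P * w ^ 6)) =O[𝓝[≠] (0 : ℝ)] fun w => w ^ 7 := by
  have hev : ∀ {p : ℝ → Prop} (k : ℝ), k ≠ 0 → (∀ᶠ w in 𝓝[≠] (0 : ℝ), p w) →
      ∀ᶠ w in 𝓝[≠] (0 : ℝ), p (k * w) := by
    intro p k hk h
    have ht : Filter.Tendsto (fun w : ℝ => k * w) (𝓝[≠] 0) (𝓝[≠] 0) := by
      refine tendsto_nhdsWithin_iff.2 ⟨by simpa using tendsto_id_punctured.const_mul k, ?_⟩
      filter_upwards [self_mem_nhdsWithin] with w hw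
      exact mul_ne_zero hk hw
    exact ht.eventually h
  have n1 : (-1 : ℝ) ≠ 0 := by norm_num
  have n2 : (-2 : ℝ) ≠ 0 := by norm_num
  have p1 : (1 : ℝ) ≠ 0 := by norm_num
  -- coordinates of the two vectors, the normal ones divided by `w ^ 2`
  obtain ⟨AT, hAT⟩ : ∃ f : ℝ → ℝ, f = fun w => 2 * ⟪q (-1 * w), b 0⟫ - ⟪q (-2 * w), b 0⟫ :=
    ⟨_, rfl⟩
  obtain ⟨BT, hBT⟩ : ∃ f : ℝ → ℝ, f = fun w => 1 / 2 * (⟪q (1 * w), b 0⟫ + ⟪q (-1 * w), b 0⟫) :=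
    ⟨_, rfl⟩
  obtain ⟨AN, hAN⟩ : ∃ f : ℝ → ℝ, f = fun w => 2 * H (-1 * w) - 4 * H (-2 * w) := ⟨_, rfl⟩
  obtain ⟨BN, hBN⟩ : ∃ f : ℝ → ℝ, f = fun w => 1 / 2 * (H (1 * w) + H (-1 * w)) := ⟨_, rfl⟩
  obtain ⟨AB, hAB⟩ : ∃ f : ℝ → ℝ, f = fun w => 2 * L (-1 * w) - 4 * L (-2 * w) := ⟨_, rfl⟩
  obtain ⟨BB, hBB⟩ : ∃ f : ℝ → ℝ, f = fun w => 1 / 2 * (L (1 * w) + L (-1 * w)) := ⟨_, rfl⟩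
  have jAT : QuadJet AT q₀ 0 (-2 * q₂) := by
    rw [hAT]
    exact (((hT.comp_const_mul n1).const_mul 2).sub (hT.comp_const_mul n2)).congr_coeff
      (by ring) (by ring) (by ring)
  have jBT : QuadJet BT q₀ 0 q₂ := by
    rw [hBT]
    exact (((hT.comp_const_mul p1).add (hT.comp_const_mul n1)).const_mul (1 / 2)).congr_coeff
      (by ring) (by ring) (by ring)
  have jAN : QuadJet AN (-2 * h₀) (6 * h₁) (-14 * h₂) := by
    rw [hAN]
    exact (((hH.comp_const_mul n1).const_mul 2).sub
      ((hH.comp_const_mul n2).const_mul 4)).congr_coeff (by ring) (by ring) (by ring)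
  have jBN : QuadJet BN h₀ 0 h₂ := by
    rw [hBN]
    exact (((hH.comp_const_mul p1).add (hH.comp_const_mul n1)).const_mul (1 / 2)).congr_coeff
      (by ring) (by ring) (by ring)
  have jAB : QuadJet AB (-2 * l₀) (6 * l₁) (-14 * l₂) := by
    rw [hAB]
    exact (((hL.comp_const_mul n1).const_mul 2).sub
      ((hL.comp_const_mul n2).const_mul 4)).congr_coeff (by ring) (by ring) (by ring)
  have jBB : QuadJet BB l₀ 0 l₂ := by
    rw [hBB]
    exact (((hL.comp_const_mul p1).add (hL.comp_const_mul n1)).const_mul (1 / 2)).congr_coeff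
      (by ring) (by ring) (by ring)
  have jW : QuadJet (fun w => w * w) 0 0 1 :=
    (QuadJet.id.mul QuadJet.id).congr_coeff (by ring) (by ring) (by ring)
  have sq : ∀ {f : ℝ → ℝ} {a b c : ℝ}, QuadJet f a b c →
      QuadJet (fun w => f w * f w) (a ^ 2) (2 * a * b) (2 * a * c + b ^ 2) := fun h =>
    (h.mul h).congr_coeff (by ring) (by ring) (by ring)
  have hnn := sq (jW.mul jAN)
  have hbb := sq (jW.mul jAB)
  have hnn' := sq (jW.mul jBN)
  have hbb' := sq (jW.mul jBB)
  -- squared lengths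
  have jA := (((sq jAT).add hnn).add hbb).congr_coeff
    (a' := q₀ ^ 2) (b' := 0) (c' := -4 * q₀ * q₂) (by ring) (by ring) (by ring)
  have jB := (((sq jBT).add hnn').add hbb').congr_coeff
    (a' := q₀ ^ 2) (b' := 0) (c' := 2 * q₀ * q₂) (by ring) (by ring) (by ring)
  have jI := ((jAT.mul jBT).add ((jW.mul jAN).mul (jW.mul jBN))).add
    ((jW.mul jAB).mul (jW.mul jBB))
  -- the Gram determinant divided by `w ^ 4`
  have jTN := ((jAT.mul jBN).sub (jAN.mul jBT)).congr_coeff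
    (a' := 3 * q₀ * h₀) (b' := -6 * q₀ * h₁) (c' := 15 * q₀ * h₂) (by ring) (by ring) (by ring)
  have jTB := ((jAT.mul jBB).sub (jAB.mul jBT)).congr_coeff
    (a' := 3 * q₀ * l₀) (b' := -6 * q₀ * l₁) (c' := 15 * q₀ * l₂) (by ring) (by ring) (by ring)
  have jNB := sq (jW.mul ((jAN.mul jBB).sub (jAB.mul jBN)))
  have jG := (((sq jTN).add (sq jTB)).add jNB).congr_coeff
    (a' := q₀ ^ 4 / 4) (b' := 0) (c' := q₀ ^ 2 * (-2 * P * q₀ ^ 2 - q₂ * q₀ / 2))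
    (by linear_combination q₀ ^ 2 / 4 * e₀) (by linear_combination -36 * q₀ ^ 2 * e₁)
    (by linear_combination q₀ ^ 2 * e₂)
  have hD := (jA.mul jB).congr_coeff (a' := q₀ ^ 4) (b' := 0) (c' := -2 * q₀ ^ 3 * q₂)
    (by ring) (by ring) (by ring)
  have jS := (jG.mul (hD.inv (pow_ne_zero 4 hq₀))).congr_coeff
    (a' := 1 / 4) (b' := 0) (c' := -2 * P) (by field_simp) (by ring) (by field_simp; ring)
  refine cos_expansion jS ?_
  have hpos : ∀ᶠ w in 𝓝[≠] (0 : ℝ), 0 < AT w * BT w + w * w * AN w * (w * w * BN w) +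
      w * w * AB w * (w * w * BB w) :=
    jI.tendsto.eventually (lt_mem_nhds (by
      have : 0 < q₀ ^ 2 := by positivity
      linarith))
  filter_upwards [hpos, hev _ n1 hN, hev _ n2 hN, hev _ p1 hN, hev _ n1 hB, hev _ n2 hB,
    hev _ p1 hB, jA.tendsto.eventually_ne (pow_ne_zero 2 hq₀),
    jB.tendsto.eventually_ne (pow_ne_zero 2 hq₀)] with w hw a1 a2 a3 b1 b2 b3 hA0 hB0
  obtain ⟨A, hA⟩ : ∃ A, A = (2 : ℝ) • q (-1 * w) - q (-2 * w) := ⟨_, rfl⟩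
  obtain ⟨B, hB⟩ : ∃ B, B = (1 / 2 : ℝ) • (q (1 * w) + q (-1 * w)) := ⟨_, rfl⟩
  rw [← hA, ← hB]
  have A0 : ⟪A, b 0⟫ = AT w := by
    rw [hA, hAT, inner_sub_left, real_inner_smul_left]
  have B0 : ⟪B, b 0⟫ = BT w := by
    rw [hB, hBT, real_inner_smul_left, inner_add_left]
  have A1 : ⟪A, b 1⟫ = w * w * AN w := by
    rw [hA, hAN, inner_sub_left, real_inner_smul_left, a1, a2]; ring
  have B1 : ⟪B, b 1⟫ = w * w * BN w := by
    rw [hB, hBN, real_inner_smul_left, inner_add_left, a1, a3]; ring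
  have A2 : ⟪A, b 2⟫ = w * w * AB w := by
    rw [hA, hAB, inner_sub_left, real_inner_smul_left, b1, b2]; ring
  have B2 : ⟪B, b 2⟫ = w * w * BB w := by
    rw [hB, hBB, real_inner_smul_left, inner_add_left, b1, b3]; ring
  have hin : ∀ y z : E3, ⟪y, z⟫ = ⟪y, b 0⟫ * ⟪z, b 0⟫ + ⟪y, b 1⟫ * ⟪z, b 1⟫ +
      ⟪y, b 2⟫ * ⟪z, b 2⟫ := by
    intro y z
    rw [← b.sum_inner_mul_inner y z, Fin.sum_univ_three, real_inner_comm z, real_inner_comm z,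
      real_inner_comm z]
  have hI := hin A B
  have hAA := hin A A
  have hBB' := hin B B
  rw [real_inner_self_eq_norm_sq] at hAA hBB'
  rw [A0, A1, A2, B0, B1, B2] at hI
  rw [A0, A1, A2] at hAA
  rw [B0, B1, B2] at hBB'
  rw [← hAA] at hA0 ⊢
  rw [← hBB'] at hB0 ⊢
  rw [← hI] at hw
  refine ⟨by positivity, ?_⟩
  have hA1 : ‖A‖ ≠ 0 := fun h => hA0 (by simp [h])
  have hB1 : ‖B‖ ≠ 0 := fun h => hB0 (by simp [h])
  have key : ‖A‖ ^ 2 * ‖B‖ ^ 2 - ⟪A, B⟫ ^ 2 = w ^ 4 * (((AT w * BN w - AN w * BT w) *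
      (AT w * BN w - AN w * BT w) + (AT w * BB w - AB w * BT w) * (AT w * BB w - AB w * BT w)) +
      (w * w * (AN w * BB w - AB w * BN w)) * (w * w * (AN w * BB w - AB w * BN w))) := by
    rw [hAA, hBB', hI]; ring
  rw [← mul_assoc, ← key]
  field_simp

/-- Expansions of the coordinates of the inverted curve `w ↦ w • sphereInv (X (w * E w))`. -/
theorem sphereInv_jets (b : OrthonormalBasis (Fin 3) ℝ E3) {X : ℝ → E3} {U Y Z E : ℝ → ℝ}
    {K K1 y₁ y₂ z₀ z₁ z₂ g r t : ℝ} (hg : g ≠ 0)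
    (hXT : ∀ ε, ε ≠ 0 → ⟪X ε, b 0⟫ = ε + ε ^ 2 * U ε)
    (hXN : ∀ ε, ε ≠ 0 → ⟪X ε, b 1⟫ = ε ^ 2 * (K / 2 + ε * Y ε))
    (hXB : ∀ ε, ε ≠ 0 → ⟪X ε, b 2⟫ = ε ^ 3 * Z ε)
    (hU : QuadJet U 0 (-K ^ 2 / 6) (-K * K1 / 8)) (hY : QuadJet Y (K1 / 6) y₁ y₂)
    (hZ : QuadJet Z z₀ z₁ z₂) (hE : QuadJet E g (g * r) (g * t)) :
    QuadJet (fun w => ⟪w • sphereInv (X (w * E w)), b 0⟫) g⁻¹ (-g⁻¹ * r)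
      (g⁻¹ * (r ^ 2 - t) - K ^ 2 / 12 * g) ∧
    (∃ H : ℝ → ℝ,
      (∀ᶠ w in 𝓝[≠] (0 : ℝ), ⟪w • sphereInv (X (w * E w)), b 1⟫ = K / 2 * w + w ^ 2 * H w) ∧
      QuadJet H (g * (K1 / 6)) (g ^ 2 * (y₁ + K ^ 3 / 24) + g * r * (K1 / 6))
        (2 * g ^ 2 * r * (y₁ + K ^ 3 / 24) + g ^ 3 * (y₂ + K ^ 2 * K1 / 18) + g * t * (K1 / 6))) ∧
    ∃ L : ℝ → ℝ,
      (∀ᶠ w in 𝓝[≠] (0 : ℝ), ⟪w • sphereInv (X (w * E w)), b 2⟫ = 0 * w + w ^ 2 * L w) ∧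
      QuadJet L (g * z₀) (g ^ 2 * z₁ + g * r * z₀)
        (2 * g ^ 2 * r * z₁ + g ^ 3 * (z₂ + K ^ 2 / 12 * z₀) + g * t * z₀) := by
  have jV := (QuadJet.const (K / 2)).add (QuadJet.id.mul hY)
  have jVB := QuadJet.id.mul hZ
  -- `‖X ε‖ ^ 2 = ε ^ 2 * (1 + ε * D ε)`
  obtain ⟨D, hD⟩ : ∃ D : ℝ → ℝ, D = fun ε => 2 * U ε + ε * (U ε * U ε) +
      ε * ((K / 2 + ε * Y ε) * (K / 2 + ε * Y ε)) + ε * ((ε * Z ε) * (ε * Z ε)) := ⟨_, rfl⟩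
  have jD : QuadJet D 0 (-K ^ 2 / 12) (-K * K1 / 12) := by
    rw [hD]
    exact ((((hU.const_mul 2).add (QuadJet.id.mul (hU.mul hU))).add
      (QuadJet.id.mul (jV.mul jV))).add (QuadJet.id.mul (jVB.mul jVB))).congr_coeff
      (by ring) (by ring) (by ring)
  have jρ := ((QuadJet.const 1).add (QuadJet.id.mul jD)).congr_coeff (a' := 1) (b' := 0)
    (c' := -K ^ 2 / 12) (by ring) (by ring) (by ring)
  have jρi := (jρ.inv one_ne_zero).congr_coeff (a' := 1) (b' := 0) (c' := K ^ 2 / 12)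
    (by ring) (by ring) (by ring)
  have hnorm : ∀ ε, ε ≠ 0 → ‖X ε‖ ^ 2 = ε ^ 2 * (1 + ε * D ε) := by
    intro ε hε
    rw [← b.sum_sq_norm_inner_left, Fin.sum_univ_three, hXT ε hε, hXN ε hε, hXB ε hε, hD]
    simp only [Real.norm_eq_abs, sq_abs]
    ring
  have jR := ((((QuadJet.const 1).add (QuadJet.id.mul hU)).mul jρi).comp_id_mul hE hg)
  have jEi := hE.inv hg
  have jJ := ((hY.sub (jD.const_mul (K / 2))).mul jρi).comp_id_mul hE hg
  have jJB := (hZ.mul jρi).comp_id_mul hE hg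
  have hne : ∀ᶠ w in 𝓝[≠] (0 : ℝ), w ≠ 0 ∧ E w ≠ 0 ∧ 1 + w * E w * D (w * E w) ≠ 0 := by
    filter_upwards [self_mem_nhdsWithin, hE.tendsto.eventually_ne hg,
      (jρ.comp_id_mul hE hg).tendsto.eventually_ne one_ne_zero] with w h1 h2 h3
    exact ⟨h1, h2, h3⟩
  refine ⟨?_, ⟨fun w => E w * ((Y (w * E w) - K / 2 * D (w * E w)) *
    (1 + w * E w * D (w * E w))⁻¹), ?_, ?_⟩, ⟨fun w => E w * (Z (w * E w) *
    (1 + w * E w * D (w * E w))⁻¹), ?_, ?_⟩⟩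
  · refine ((jEi.mul jR).congr_fun ?_).congr_coeff (by ring) (by field_simp; ring)
      (by field_simp; ring)
    filter_upwards [hne] with w ⟨h1, h2, h3⟩
    rw [sphereInv, real_inner_smul_left, real_inner_smul_left, hnorm _ (mul_ne_zero h1 h2),
      hXT _ (mul_ne_zero h1 h2)]
    field_simp
  · filter_upwards [hne] with w ⟨h1, h2, h3⟩
    rw [sphereInv, real_inner_smul_left, real_inner_smul_left, hnorm _ (mul_ne_zero h1 h2),
      hXN _ (mul_ne_zero h1 h2)]
    field_simp
    ring
  · exact (hE.mul jJ).congr_coeff (by ring) (by ring) (by ring)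
  · filter_upwards [hne] with w ⟨h1, h2, h3⟩
    rw [sphereInv, real_inner_smul_left, real_inner_smul_left, hnorm _ (mul_ne_zero h1 h2),
      hXB _ (mul_ne_zero h1 h2)]
    field_simp
    ring
  · exact (hE.mul jJB).congr_coeff (by ring) (by ring) (by ring)

/-- The angle expansion for a curve with Frenet data `K`, `T0` and their derivatives,
parametrized to third order by conformal arclength. -/
theorem conformal_angle_expansion (b : OrthonormalBasis (Fin 3) ℝ E3) {X : ℝ → E3}
    {U Y Z E : ℝ → ℝ} {K K1 K2 K3 T0 T1 T2 M M1 M2 g P : ℝ}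
    (hM : M = K1 ^ 2 + K ^ 2 * T0 ^ 2)
    (hM1 : M1 = 2 * K1 * K2 + 2 * K * K1 * T0 ^ 2 + 2 * K ^ 2 * T0 * T1)
    (hM2 : M2 = 2 * K2 ^ 2 + 2 * K1 * K3 + 2 * K1 ^ 2 * T0 ^ 2 + 2 * K * K2 * T0 ^ 2 +
      8 * K * K1 * T0 * T1 + 2 * K ^ 2 * T1 ^ 2 + 2 * K ^ 2 * T0 * T2)
    (hg : g ^ 4 * M = 1)
    (hP : P = (2 * K * T0 * K1 ^ 2 * (20 * K1 * T1 - 19 * T0 * K2) +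
          2 * K ^ 3 * T0 ^ 3 * (5 * K1 * T1 - 4 * T0 * K2) +
          K1 ^ 2 * (28 * T0 ^ 2 * K1 ^ 2 - 5 * K2 ^ 2 + 4 * K1 * K3) +
          K ^ 2 * (19 * T0 ^ 4 * K1 ^ 2 - 4 * K1 ^ 4 + 10 * K1 ^ 2 * T1 ^ 2 +
            2 * T0 * K1 * (2 * K1 * T2 - 15 * T1 * K2) +
            2 * T0 ^ 2 * (5 * K2 ^ 2 + 2 * K1 * K3)) +
          K ^ 4 * T0 ^ 2 * (6 * T0 ^ 4 - 8 * K1 ^ 2 - 5 * T1 ^ 2 + 4 * T0 * T2) -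
          4 * K ^ 6 * T0 ^ 4) * g ^ 10 / 192)
    (hXT : ∀ ε, ε ≠ 0 → ⟪X ε, b 0⟫ = ε + ε ^ 2 * U ε)
    (hXN : ∀ ε, ε ≠ 0 → ⟪X ε, b 1⟫ = ε ^ 2 * (K / 2 + ε * Y ε))
    (hXB : ∀ ε, ε ≠ 0 → ⟪X ε, b 2⟫ = ε ^ 3 * Z ε)
    (hU : QuadJet U 0 (-K ^ 2 / 6) (-K * K1 / 8))
    (hY : QuadJet Y (K1 / 6) ((K2 - K ^ 3 - K * T0 ^ 2) / 24)
      ((K3 - 6 * K ^ 2 * K1 - 3 * K1 * T0 ^ 2 - 3 * K * T0 * T1) / 120))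
    (hZ : QuadJet Z (K * T0 / 6) ((2 * K1 * T0 + K * T1) / 24)
      ((3 * K2 * T0 + 3 * K1 * T1 + K * T2 - K ^ 3 * T0 - K * T0 ^ 3) / 120))
    (hE : QuadJet E g (-g ^ 6 * M1 / 8) ((3 / 8 * g ^ 11 * M1 ^ 2 - g ^ 7 * M2 / 4) / 6))
    {q : ℝ → E3} (hq : ∀ w, q w = w • sphereInv (X (w * E w))) :
    (fun w => ⟪(2 : ℝ) • q (-1 * w) - q (-2 * w), (1 / 2 : ℝ) • (q (1 * w) + q (-1 * w))⟫ /
        (‖(2 : ℝ) • q (-1 * w) - q (-2 * w)‖ * ‖(1 / 2 : ℝ) • (q (1 * w) + q (-1 * w))‖) -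
      (1 - w ^ 4 / 8 + P * w ^ 6)) =O[𝓝[≠] (0 : ℝ)] fun w => w ^ 7 := by
  have hg0 : g ≠ 0 := by
    rintro rfl
    norm_num at hg
  obtain ⟨hT, ⟨H, hN, hH⟩, L, hB, hL⟩ := sphereInv_jets b (r := -g ^ 5 * M1 / 8)
    (t := (3 / 8 * g ^ 10 * M1 ^ 2 - g ^ 6 * M2 / 4) / 6) hg0 hXT hXN hXB hU hY hZ
    (hE.congr_coeff rfl (by ring) (by ring))
  simp only [← hq] at hT hN hB
  have hi : g⁻¹ * g = 1 := inv_mul_cancel₀ hg0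
  refine angle_expansion b (inv_ne_zero hg0) hT hN hB hH hL ?_ ?_ ?_
  · linear_combination g⁻¹ ^ 2 * hg - g ^ 2 * M * (g⁻¹ * g + 1) * hi - g ^ 2 * hM
  · rw [hM, hM1] at *
    linear_combination
      (-g ^ 3 * (2 * K1 * K2 + 2 * K * K1 * T0 ^ 2 + 2 * K ^ 2 * T0 * T1) / 288) * hg
  · have hq₂ : g⁻¹ * ((-g ^ 5 * M1 / 8) ^ 2 - (3 / 8 * g ^ 10 * M1 ^ 2 - g ^ 6 * M2 / 4) / 6) -
        K ^ 2 / 12 * g = g * (-3 / 64 * g ^ 8 * M1 ^ 2 + g ^ 4 * M2 / 24 - K ^ 2 / 12) := by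
      field_simp
      ring
    have hPg : -2 * P * g⁻¹ ^ 2 = -2 * (P / g ^ 2) := by rw [inv_pow, div_eq_mul_inv]; ring
    have hQ : g * (-3 / 64 * g ^ 8 * M1 ^ 2 + g ^ 4 * M2 / 24 - K ^ 2 / 12) * g⁻¹ =
        -3 / 64 * g ^ 8 * M1 ^ 2 + g ^ 4 * M2 / 24 - K ^ 2 / 12 := by
      field_simp
    rw [hq₂, hQ, hPg, hP]
    have hcancel : ∀ n : ℝ, n * g ^ 10 / 192 / g ^ 2 = n * g ^ 8 / 192 := fun n => by field_simp
    rw [hcancel]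
    obtain ⟨j, hj⟩ : ∃ j, j = 36 * (((K2 - K * T0 ^ 2) / 24) ^ 2 +
        ((2 * K1 * T0 + K * T1) / 24) ^ 2) + 90 * (K1 / 6 * ((K3 - 6 * K ^ 2 * K1 -
        3 * K1 * T0 ^ 2 - 3 * K * T0 * T1) / 120 + K ^ 2 * K1 / 18) + K * T0 / 6 *
        ((3 * K2 * T0 + 3 * K1 * T1 + K * T2 - K ^ 3 * T0 - K * T0 ^ 3) / 120 +
        K ^ 2 / 12 * (K * T0 / 6))) + M2 / 48 := ⟨_, rfl⟩
    have key : 11 / 64 * g ^ 8 * M1 ^ 2 * (g ^ 4 * M - 1) - g ^ 4 * j * (g ^ 4 * M - 1) +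
        K ^ 2 / 24 * (g ^ 4 * M + 1) * (g ^ 4 * M - 1) = 0 := by
      rw [hg]; ring
    rw [← sub_eq_zero, ← key, hj, hM, hM1, hM2]
    ring

/-- A local inverse of an indefinite integral of a positive continuous function is
differentiable near `0`. -/
theorem hasDerivAt_localInverse_integral {f ω e : ℝ → ℝ} {s₀ : ℝ}
    (hf : ∀ᶠ s in 𝓝 s₀, ContinuousAt f s) (hpos : ∀ᶠ s in 𝓝 s₀, 0 < f s)
    (hω : ∀ ε, ω ε = ∫ s in s₀..(s₀ + ε), f s) (he0 : e 0 = 0) (hecont : ContinuousAt e 0)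
    (hinv : ∀ᶠ w in 𝓝 (0 : ℝ), ω (e w) = w) :
    ∀ᶠ w in 𝓝 (0 : ℝ), ContinuousAt e w ∧ HasDerivAt e (f (s₀ + e w))⁻¹ w := by
  have hshift : Filter.Tendsto (fun ε : ℝ => s₀ + ε) (𝓝 0) (𝓝 s₀) := by
    have : Continuous fun ε : ℝ => s₀ + ε := by fun_prop
    simpa using this.tendsto 0
  have hωd : ∀ᶠ ε in 𝓝 (0 : ℝ), HasDerivAt ω (f (s₀ + ε)) ε := by
    obtain ⟨r, hr, hball⟩ := Metric.eventually_nhds_iff_ball.1 hf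
    have hc : ContinuousOn f (Metric.ball s₀ r) := fun s hs => (hball s hs).continuousWithinAt
    filter_upwards [hshift (Metric.ball_mem_nhds s₀ hr)] with ε hε
    have hε : s₀ + ε ∈ Metric.ball s₀ r := hε
    have hsub : Set.uIcc s₀ (s₀ + ε) ⊆ Metric.ball s₀ r :=
      ((convex_ball s₀ r).ordConnected).uIcc_subset (Metric.mem_ball_self hr) hε
    have h := intervalIntegral.integral_hasDerivAt_right (hc.mono hsub).intervalIntegrable
      (hc.stronglyMeasurableAtFilter Metric.isOpen_ball _ hε) (hball _ hε)
    rw [funext hω]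
    simpa [Function.comp_def] using! h.comp ε ((hasDerivAt_id ε).const_add s₀)
  have hf0 : ContinuousAt (fun ε => f (s₀ + ε)) 0 :=
    ContinuousAt.comp (by simpa using hf.self_of_nhds) (by fun_prop)
  have hne : f (s₀ + 0) ≠ 0 := by simpa using hpos.self_of_nhds.ne'
  have hstrict := hasStrictDerivAt_of_hasDerivAt_of_continuousAt hωd hf0
  have hetend : Filter.Tendsto e (𝓝 0) (𝓝 0) := by simpa [ContinuousAt, he0] using hecont
  have hω0 : ω 0 = 0 := by simp [hω]
  have heq : e =ᶠ[𝓝 0] hstrict.localInverse ω _ 0 hne := by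
    filter_upwards [hinv, hetend.eventually (hstrict.eventually_left_inverse hne)] with w h1 h2
    rw [h1] at h2
    exact h2.symm
  have hestrict : HasStrictDerivAt e (f (s₀ + 0))⁻¹ 0 := by
    have h := hstrict.to_localInverse hne
    rw [hω0] at h
    exact h.congr_of_eventuallyEq heq.symm
  obtain ⟨C, t, ht, hlip⟩ := hestrict.hasStrictFDerivAt.exists_lipschitzOnWith
  filter_upwards [eventually_mem_nhds_iff.2 ht, eventually_eventually_nhds.2 hinv,
    hetend.eventually hωd, (hshift.comp hetend).eventually hpos] with w h1 h2 h3 h4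
  have hc := hlip.continuousOn.continuousAt h1
  exact ⟨hc, HasDerivAt.of_local_left_inverse hc h3 (ne_of_gt h4) h2⟩

theorem hasDerivAt_inv_sqrt_sqrt {M : ℝ → ℝ} {M' s : ℝ} (h : HasDerivAt M M' s) (hpos : 0 < M s) :
    HasDerivAt (fun s => (√(√(M s)))⁻¹) (-((√(√(M s)))⁻¹ ^ 5 * M') / 4) s := by
  have h1 : 0 < √(M s) := Real.sqrt_pos.2 hpos
  have h2 : 0 < √(√(M s)) := Real.sqrt_pos.2 h1
  refine ((h.sqrt hpos.ne').sqrt h1.ne').fun_inv h2.ne' |>.congr_deriv ?_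
  nth_rewrite 1 [← Real.sq_sqrt h1.le]
  field_simp
  norm_num

/-- The second-order jet of `e(w) / w` for the inverse `e` of `ε ↦ ∫ √√M`. -/
theorem quadJet_localInverse_integral {M M' M'' ω e : ℝ → ℝ} {s₀ : ℝ}
    (hM : ∀ᶠ s in 𝓝 s₀, HasDerivAt M (M' s) s) (hM' : ∀ᶠ s in 𝓝 s₀, HasDerivAt M' (M'' s) s)
    (hM'' : DifferentiableAt ℝ M'' s₀) (hpos : ∀ᶠ s in 𝓝 s₀, 0 < M s)
    (hω : ∀ ε, ω ε = ∫ s in s₀..(s₀ + ε), √(√(M s))) (he0 : e 0 = 0) (hecont : ContinuousAt e 0)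
    (hinv : ∀ᶠ w in 𝓝 (0 : ℝ), ω (e w) = w) :
    ∃ g, 0 < g ∧ g ^ 4 * M s₀ = 1 ∧ QuadJet (fun w => e w / w) g (-g ^ 6 * M' s₀ / 8)
      ((3 / 8 * g ^ 11 * M' s₀ ^ 2 - g ^ 7 * M'' s₀ / 4) / 6) := by
  have hed := hasDerivAt_localInverse_integral (f := fun s => √(√(M s)))
    (hM.mono fun s hs => (hs.continuousAt.sqrt).sqrt)
    (hpos.mono fun s hs => Real.sqrt_pos.2 (Real.sqrt_pos.2 hs)) hω he0 hecont hinv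
  obtain ⟨G, hG⟩ : ∃ G : ℝ → ℝ, G = fun s => (√(√(M s)))⁻¹ := ⟨_, rfl⟩
  have hGd : ∀ᶠ s in 𝓝 s₀, HasDerivAt G (-(G s ^ 5 * M' s) / 4) s := by
    filter_upwards [hM, hpos] with s h1 h2
    rw [hG]
    exact hasDerivAt_inv_sqrt_sqrt h1 h2
  have hM0 := hpos.self_of_nhds
  have hG0 : 0 < G s₀ := by rw [hG]; positivity
  have hpt : Filter.Tendsto (fun w => s₀ + e w) (𝓝 0) (𝓝 s₀) := by
    simpa [ContinuousAt, he0] using hecont.const_add s₀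
  have hed' : ∀ᶠ w in 𝓝 (0 : ℝ), HasDerivAt e (G (s₀ + e w)) w :=
    hed.mono fun w hw => by rw [hG]; exact hw.2
  let F : ℕ → ℝ → ℝ := fun k w => match k with
    | 0 => e w
    | 1 => G (s₀ + e w)
    | 2 => -(G (s₀ + e w) ^ 6 * M' (s₀ + e w)) / 4
    | _ => 3 / 8 * G (s₀ + e w) ^ 11 * M' (s₀ + e w) ^ 2 - G (s₀ + e w) ^ 7 * M'' (s₀ + e w) / 4
  have htaylor := taylor_isBigO_of_hasDerivAt (a := 0) 3 F ?_ ?_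
  · refine ⟨G s₀, hG0, ?_, quadJet_of_isBigO (F := e) 1 ?_ ?_⟩
    · have h1 : √(√(M s₀)) ^ 4 = M s₀ := by
        rw [show 4 = 2 * 2 from rfl, pow_mul, Real.sq_sqrt (Real.sqrt_nonneg _),
          Real.sq_sqrt hM0.le]
      rw [hG]
      simp only [inv_pow, h1]
      exact inv_mul_cancel₀ hM0.ne'
    · refine ((htaylor.mono nhdsWithin_le_nhds).congr_left fun w => ?_).congr_right fun w => ?_
      · simp only [Finset.sum_range_succ, Finset.sum_range_zero, F, he0, smul_eq_mul, add_zero,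
          sub_zero, Nat.factorial]
        push_cast
        ring
      · simp
    · filter_upwards [self_mem_nhdsWithin] with w hw
      have hw : w ≠ 0 := hw
      field_simp
  · intro k hk
    interval_cases k
    · exact hed'
    · filter_upwards [hed', hpt.eventually hGd] with w h1 h2
      refine (h2.comp w (h1.const_add s₀)).congr_deriv ?_
      simp only [F]
      ring
    · filter_upwards [hed', hpt.eventually hGd, hpt.eventually hM'] with w h1 h2 h3
      have h4 := h2.comp w (h1.const_add s₀)
      have h5 := h3.comp w (h1.const_add s₀)
      refine ((((h4.pow 6).mul h5).neg).div_const 4).congr_deriv ?_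
      simp only [F, Pi.pow_apply, Function.comp_apply]
      push_cast
      ring
  · have h1 : DifferentiableAt ℝ (fun w => s₀ + e w) 0 :=
      hed'.self_of_nhds.differentiableAt.const_add s₀
    have hs : s₀ + e 0 = s₀ := by simp [he0]
    have h2 : DifferentiableAt ℝ (fun w => G (s₀ + e w)) 0 :=
      DifferentiableAt.comp (g := G) 0 (by rw [hs]; exact hGd.self_of_nhds.differentiableAt) h1
    have h3 : DifferentiableAt ℝ (fun w => M' (s₀ + e w)) 0 :=
      DifferentiableAt.comp (g := M') 0 (by rw [hs]; exact hM'.self_of_nhds.differentiableAt) h1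
    have h4 : DifferentiableAt ℝ (fun w => M'' (s₀ + e w)) 0 :=
      DifferentiableAt.comp (g := M'') 0 (by rw [hs]; exact hM'') h1
    exact (((h2.pow 11).const_mul _).mul (h3.pow 2)).sub (((h2.pow 7).mul h4).div_const 4)

theorem contDiffAt_iteratedDeriv {E : Type*} [NormedAddCommGroup E] [NormedSpace ℝ E] {f : ℝ → E}
    {s₀ : ℝ} (hf : ContDiffAt ℝ (⊤ : ℕ∞) f s₀) (k : ℕ) :
    ContDiffAt ℝ (⊤ : ℕ∞) (iteratedDeriv k f) s₀ := by
  induction k with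
  | zero => simpa using hf
  | succ k ih =>
    rw [iteratedDeriv_succ]
    exact ih.derivWithin (by simp)

theorem eventually_hasDerivAt_iteratedDeriv {E : Type*} [NormedAddCommGroup E] [NormedSpace ℝ E]
    {f : ℝ → E} {s₀ : ℝ} (hf : ContDiffAt ℝ (⊤ : ℕ∞) f s₀) (k : ℕ) :
    ∀ᶠ s in 𝓝 s₀, HasDerivAt (iteratedDeriv k f) (iteratedDeriv (k + 1) f s) s := by
  have h : ContDiffAt ℝ 1 (iteratedDeriv k f) s₀ := (contDiffAt_iteratedDeriv hf k).of_le
    (by exact_mod_cast le_top)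
  filter_upwards [h.eventually (by simp)] with s hs
  rw [iteratedDeriv_succ]
  exact (hs.differentiableAt one_ne_zero).hasDerivAt

theorem inner_cross3 (u v w : E3) : ⟪cross3 u v, w⟫ =
    (u 1 * v 2 - u 2 * v 1) * w 0 + (u 2 * v 0 - u 0 * v 2) * w 1 +
      (u 0 * v 1 - u 1 * v 0) * w 2 := by
  simp [PiLp.inner_apply, Fin.sum_univ_three, cross3]
  ring

theorem inner_eq_sum_three (u v : E3) : ⟪u, v⟫ = u 0 * v 0 + u 1 * v 1 + u 2 * v 2 := by
  simp [PiLp.inner_apply, Fin.sum_univ_three]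
  ring

theorem inner_cross3_left (u v : E3) : ⟪cross3 u v, u⟫ = 0 := by
  rw [inner_cross3]; ring

theorem inner_cross3_right (u v : E3) : ⟪cross3 u v, v⟫ = 0 := by
  rw [inner_cross3]; ring

theorem inner_cross3_self (u v : E3) :
    ⟪cross3 u v, cross3 u v⟫ = ⟪u, u⟫ * ⟪v, v⟫ - ⟪u, v⟫ ^ 2 := by
  rw [inner_cross3]
  simp only [inner_eq_sum_three]
  simp [cross3]
  ring

theorem inner_cross3_smul (c : ℝ) (u v w : E3) : ⟪cross3 u (c • v), w⟫ = c * ⟪cross3 u v, w⟫ := by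
  simp only [inner_cross3, PiLp.smul_apply, smul_eq_mul]; ring

theorem differentiableAt_cross3 {f g : ℝ → E3} {s : ℝ} (hf : DifferentiableAt ℝ f s)
    (hg : DifferentiableAt ℝ g s) : DifferentiableAt ℝ (fun t => cross3 (f t) (g t)) s := by
  have hf := differentiableAt_euclidean.1 hf
  have hg := differentiableAt_euclidean.1 hg
  refine differentiableAt_euclidean.2 fun i => ?_
  fin_cases i <;> simp only [cross3] <;>
    exact ((hf _).mul (hg _)).sub ((hf _).mul (hg _))

theorem contDiffAt_inner_cross3 {f g h : ℝ → E3} {s : ℝ} {n : WithTop ℕ∞}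
    (hf : ContDiffAt ℝ n f s) (hg : ContDiffAt ℝ n g s) (hh : ContDiffAt ℝ n h s) :
    ContDiffAt ℝ n (fun t => ⟪cross3 (f t) (g t), h t⟫) s := by
  have hf := contDiffAt_euclidean.1 hf
  have hg := contDiffAt_euclidean.1 hg
  have hh := contDiffAt_euclidean.1 hh
  simp only [inner_cross3]
  exact (((((hf 1).mul (hg 2)).sub ((hf 2).mul (hg 1))).mul (hh 0)).add
    ((((hf 2).mul (hg 0)).sub ((hf 0).mul (hg 2))).mul (hh 1))).add
    ((((hf 0).mul (hg 1)).sub ((hf 1).mul (hg 0))).mul (hh 2))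

theorem contDiffAt_curv {x : ℝ → E3} {s₀ : ℝ} (hx : ContDiffAt ℝ (⊤ : ℕ∞) x s₀)
    (hκ : 0 < curv x s₀) : ContDiffAt ℝ (⊤ : ℕ∞) (curv x) s₀ :=
  (contDiffAt_iteratedDeriv hx 2).norm ℝ (norm_pos_iff.1 hκ)

theorem contDiffAt_tors {x : ℝ → E3} {s₀ : ℝ} (hx : ContDiffAt ℝ (⊤ : ℕ∞) x s₀)
    (hκ : 0 < curv x s₀) : ContDiffAt ℝ (⊤ : ℕ∞) (tors x) s₀ := by
  have h1 := contDiffAt_iteratedDeriv hx 1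
  rw [iteratedDeriv_one] at h1
  exact (contDiffAt_inner_cross3 h1 (contDiffAt_iteratedDeriv hx 2)
    (contDiffAt_iteratedDeriv hx 3)).div ((contDiffAt_curv hx hκ).pow 2) (ne_of_gt (pow_pos hκ 2))

/-- The principal normal of an arclength-parametrized curve. -/
def principalNormal (x : ℝ → E3) (s : ℝ) : E3 := (curv x s)⁻¹ • iteratedDeriv 2 x s

/-- The binormal of an arclength-parametrized curve. -/
def binormal (x : ℝ → E3) (s : ℝ) : E3 := cross3 (deriv x s) (principalNormal x s)

theorem inner_hasDerivAt_self_eq_zero {f : ℝ → E3} {f' : E3} {s : ℝ} (hf : HasDerivAt f f' s)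
    (h : ∀ᶠ t in 𝓝 s, ⟪f t, f t⟫ = 1) : ⟪f', f s⟫ = 0 := by
  have h1 := (hf.inner ℝ hf).unique
    ((hasDerivAt_const s (1 : ℝ)).congr_of_eventuallyEq h)
  rw [real_inner_comm] at h1
  linarith

theorem inner_hasDerivAt_eq_neg {f g : ℝ → E3} {f' g' : E3} {s : ℝ} (hf : HasDerivAt f f' s)
    (hg : HasDerivAt g g' s) (h : ∀ᶠ t in 𝓝 s, ⟪f t, g t⟫ = 0) : ⟪f', g s⟫ = -⟪f s, g'⟫ := by
  have h1 := (hf.inner ℝ hg).unique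
    ((hasDerivAt_const s (0 : ℝ)).congr_of_eventuallyEq h)
  linarith

theorem exists_orthonormalBasis_of_three {u v w : E3} (huu : ⟪u, u⟫ = 1) (hvv : ⟪v, v⟫ = 1)
    (hww : ⟪w, w⟫ = 1) (hvu : ⟪v, u⟫ = 0) (hwu : ⟪w, u⟫ = 0) (hwv : ⟪w, v⟫ = 0) :
    ∃ b : OrthonormalBasis (Fin 3) ℝ E3, b 0 = u ∧ b 1 = v ∧ b 2 = w := by
  have h : Orthonormal ℝ ![u, v, w] := by
    have huv : ⟪u, v⟫ = 0 := by rw [real_inner_comm, hvu]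
    have huw : ⟪u, w⟫ = 0 := by rw [real_inner_comm, hwu]
    have hvw : ⟪v, w⟫ = 0 := by rw [real_inner_comm, hwv]
    rw [orthonormal_iff_ite]
    intro i j
    fin_cases i <;> fin_cases j <;>
      first
      | exact huu | exact huv | exact huw | exact hvu | exact hvv | exact hvw | exact hwu
      | exact hwv | exact hww
  have hcard : Fintype.card (Fin 3) = Module.finrank ℝ E3 := by simp
  refine ⟨(basisOfOrthonormalOfCardEqFinrank h hcard).toOrthonormalBasis (by simpa using h), ?_⟩
  simp

theorem eq_sum_inner_of_orthonormal {u v w : E3} (huu : ⟪u, u⟫ = 1) (hvv : ⟪v, v⟫ = 1)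
    (hww : ⟪w, w⟫ = 1) (hvu : ⟪v, u⟫ = 0) (hwu : ⟪w, u⟫ = 0) (hwv : ⟪w, v⟫ = 0) (y : E3) :
    y = ⟪y, u⟫ • u + ⟪y, v⟫ • v + ⟪y, w⟫ • w := by
  obtain ⟨b, rfl, rfl, rfl⟩ := exists_orthonormalBasis_of_three huu hvv hww hvu hwu hwv
  have h := b.sum_repr' y
  rw [Fin.sum_univ_three] at h
  rw [real_inner_comm (b 0), real_inner_comm (b 1), real_inner_comm (b 2), h]

theorem hasDerivAt_iteratedDeriv {x : ℝ → E3} (hx : ContDiff ℝ (⊤ : ℕ∞) x) (k : ℕ) (s : ℝ) :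
    HasDerivAt (iteratedDeriv k x) (iteratedDeriv (k + 1) x s) s :=
  (eventually_hasDerivAt_iteratedDeriv hx.contDiffAt k).self_of_nhds

theorem hasDerivAt_deriv {x : ℝ → E3} (hx : ContDiff ℝ (⊤ : ℕ∞) x) (s : ℝ) :
    HasDerivAt (deriv x) (iteratedDeriv 2 x s) s := by
  simpa using hasDerivAt_iteratedDeriv hx 1 s

theorem curv_smul_principalNormal {x : ℝ → E3} {s : ℝ} (hκ : 0 < curv x s) :
    curv x s • principalNormal x s = iteratedDeriv 2 x s := by
  rw [principalNormal, smul_smul, mul_inv_cancel₀ hκ.ne', one_smul]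

theorem inner_principalNormal_self {x : ℝ → E3} {s : ℝ} (hκ : 0 < curv x s) :
    ⟪principalNormal x s, principalNormal x s⟫ = 1 := by
  rw [principalNormal, real_inner_smul_left, real_inner_smul_right, real_inner_self_eq_norm_sq]
  change (curv x s)⁻¹ * ((curv x s)⁻¹ * curv x s ^ 2) = 1
  field_simp

theorem inner_binormal_deriv (x : ℝ → E3) (s : ℝ) : ⟪binormal x s, deriv x s⟫ = 0 :=
  inner_cross3_left _ _

theorem inner_binormal_principalNormal (x : ℝ → E3) (s : ℝ) :
    ⟪binormal x s, principalNormal x s⟫ = 0 :=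
  inner_cross3_right _ _

section Frenet

variable {x : ℝ → E3} {s₀ : ℝ}

theorem inner_deriv_self (harc : ∀ s, ‖deriv x s‖ = 1) (s : ℝ) : ⟪deriv x s, deriv x s⟫ = 1 := by
  rw [real_inner_self_eq_norm_sq, harc, one_pow]

theorem inner_principalNormal_deriv (hx : ContDiff ℝ (⊤ : ℕ∞) x) (harc : ∀ s, ‖deriv x s‖ = 1)
    (s : ℝ) : ⟪principalNormal x s, deriv x s⟫ = 0 := by
  rw [principalNormal, real_inner_smul_left, inner_hasDerivAt_self_eq_zero (hasDerivAt_deriv hx s)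
    (Filter.Eventually.of_forall (inner_deriv_self harc)), mul_zero]

theorem inner_binormal_self (hx : ContDiff ℝ (⊤ : ℕ∞) x) (harc : ∀ s, ‖deriv x s‖ = 1) {s : ℝ}
    (hκ : 0 < curv x s) : ⟪binormal x s, binormal x s⟫ = 1 := by
  rw [binormal, inner_cross3_self, inner_deriv_self harc, inner_principalNormal_self hκ,
    real_inner_comm, inner_principalNormal_deriv hx harc]
  norm_num

theorem eq_sum_frenet (hx : ContDiff ℝ (⊤ : ℕ∞) x) (harc : ∀ s, ‖deriv x s‖ = 1) {s : ℝ}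
    (hκ : 0 < curv x s) (y : E3) :
    y = ⟪y, deriv x s⟫ • deriv x s + ⟪y, principalNormal x s⟫ • principalNormal x s +
      ⟪y, binormal x s⟫ • binormal x s :=
  eq_sum_inner_of_orthonormal (inner_deriv_self harc s) (inner_principalNormal_self hκ)
    (inner_binormal_self hx harc hκ) (inner_principalNormal_deriv hx harc s)
    (inner_binormal_deriv x s) (inner_binormal_principalNormal x s) y

theorem hasDerivAt_principalNormal (hx : ContDiff ℝ (⊤ : ℕ∞) x) (harc : ∀ s, ‖deriv x s‖ = 1)
    (hκ : ∀ᶠ s in 𝓝 s₀, 0 < curv x s) :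
    HasDerivAt (principalNormal x) (-curv x s₀ • deriv x s₀ + tors x s₀ • binormal x s₀) s₀ := by
  have hκ₀ := hκ.self_of_nhds
  have hinv := ((contDiffAt_curv hx.contDiffAt hκ₀).differentiableAt
    (by simp)).hasDerivAt.fun_inv hκ₀.ne'
  have hN := hinv.smul (hasDerivAt_iteratedDeriv hx 2 s₀)
  have hN : HasDerivAt (principalNormal x) _ s₀ := hN
  obtain ⟨N', hN'⟩ : ∃ N', N' = (curv x s₀)⁻¹ • iteratedDeriv (2 + 1) x s₀ +
    (-deriv (curv x) s₀ / curv x s₀ ^ 2) • iteratedDeriv 2 x s₀ := ⟨_, rfl⟩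
  rw [← hN'] at hN
  refine hN.congr_deriv ?_
  rw [eq_sum_frenet hx harc hκ₀ N', inner_hasDerivAt_self_eq_zero hN
    (hκ.mono fun s hs => inner_principalNormal_self hs),
    inner_hasDerivAt_eq_neg hN (hasDerivAt_deriv hx s₀)
    (Filter.Eventually.of_forall (inner_principalNormal_deriv hx harc)),
    ← curv_smul_principalNormal hκ₀, real_inner_smul_right, inner_principalNormal_self hκ₀]
  have hB : ⟪N', binormal x s₀⟫ = tors x s₀ := by
    rw [real_inner_comm, hN', inner_add_right, ← curv_smul_principalNormal hκ₀,
      real_inner_smul_right, real_inner_smul_right, real_inner_smul_right,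
      inner_binormal_principalNormal, binormal, principalNormal, inner_cross3_smul, tors]
    field_simp
    ring
  rw [hB]
  simp

theorem hasDerivAt_binormal (hx : ContDiff ℝ (⊤ : ℕ∞) x) (harc : ∀ s, ‖deriv x s‖ = 1)
    (hκ : ∀ᶠ s in 𝓝 s₀, 0 < curv x s) :
    HasDerivAt (binormal x) (-tors x s₀ • principalNormal x s₀) s₀ := by
  have hκ₀ := hκ.self_of_nhds
  have hT := hasDerivAt_deriv hx s₀
  have hN := hasDerivAt_principalNormal hx harc hκ
  have hB : HasDerivAt (binormal x) _ s₀ :=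
    (differentiableAt_cross3 hT.differentiableAt hN.differentiableAt).hasDerivAt
  refine hB.congr_deriv ?_
  obtain ⟨B', hB'⟩ : ∃ B', B' = deriv (fun t => cross3 (deriv x t) (principalNormal x t)) s₀ :=
    ⟨_, rfl⟩
  rw [← hB'] at hB ⊢
  rw [eq_sum_frenet hx harc hκ₀ B', inner_hasDerivAt_self_eq_zero hB
    (hκ.mono fun s hs => inner_binormal_self hx harc hs),
    inner_hasDerivAt_eq_neg hB hT (Filter.Eventually.of_forall (inner_binormal_deriv x)),
    inner_hasDerivAt_eq_neg hB hN (Filter.Eventually.of_forall (inner_binormal_principalNormal x)),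
    ← curv_smul_principalNormal hκ₀, real_inner_smul_right, inner_add_right,
    real_inner_smul_right, real_inner_smul_right, inner_binormal_self hx harc hκ₀,
    inner_binormal_principalNormal, inner_binormal_deriv]
  simp

/-- Differentiation of a curve given in the moving Frenet frame. -/
theorem eventually_deriv_frenet (hx : ContDiff ℝ (⊤ : ℕ∞) x) (harc : ∀ s, ‖deriv x s‖ = 1)
    (hκ : ∀ᶠ s in 𝓝 s₀, 0 < curv x s) {f : ℝ → E3} {a b c a' b' c' : ℝ → ℝ}
    (ha : ∀ᶠ s in 𝓝 s₀, HasDerivAt a (a' s) s) (hb : ∀ᶠ s in 𝓝 s₀, HasDerivAt b (b' s) s)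
    (hc : ∀ᶠ s in 𝓝 s₀, HasDerivAt c (c' s) s)
    (hf : ∀ᶠ s in 𝓝 s₀,
      f s = a s • deriv x s + b s • principalNormal x s + c s • binormal x s) :
    ∀ᶠ s in 𝓝 s₀, deriv f s = (a' s - curv x s * b s) • deriv x s +
      (b' s + curv x s * a s - tors x s * c s) • principalNormal x s +
      (c' s + tors x s * b s) • binormal x s := by
  filter_upwards [ha, hb, hc, eventually_eventually_nhds.2 hκ, eventually_eventually_nhds.2 hf]
    with s ha hb hc hκ hf
  have hT := hasDerivAt_deriv hx s
  rw [← curv_smul_principalNormal hκ.self_of_nhds] at hT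
  have h := ((ha.smul hT).add (hb.smul (hasDerivAt_principalNormal hx harc hκ))).add
    (hc.smul (hasDerivAt_binormal hx harc hκ))
  rw [(h.congr_of_eventuallyEq hf).deriv]
  module

theorem eventually_hasDerivAt_curv (hx : ContDiff ℝ (⊤ : ℕ∞) x) (hκ : 0 < curv x s₀) (k : ℕ) :
    ∀ᶠ s in 𝓝 s₀, HasDerivAt (iteratedDeriv k (curv x)) (iteratedDeriv (k + 1) (curv x) s) s :=
  eventually_hasDerivAt_iteratedDeriv (contDiffAt_curv hx.contDiffAt hκ) k

theorem eventually_hasDerivAt_tors (hx : ContDiff ℝ (⊤ : ℕ∞) x) (hκ : 0 < curv x s₀) (k : ℕ) :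
    ∀ᶠ s in 𝓝 s₀, HasDerivAt (iteratedDeriv k (tors x)) (iteratedDeriv (k + 1) (tors x) s) s :=
  eventually_hasDerivAt_iteratedDeriv (contDiffAt_tors hx.contDiffAt hκ) k

/-- The third derivative of a curve in its Frenet frame. -/
theorem eventually_iteratedDeriv_three (hx : ContDiff ℝ (⊤ : ℕ∞) x) (harc : ∀ s, ‖deriv x s‖ = 1)
    (hκ : ∀ᶠ s in 𝓝 s₀, 0 < curv x s) :
    ∀ᶠ s in 𝓝 s₀, iteratedDeriv 3 x s = (-curv x s ^ 2) • deriv x s +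
      iteratedDeriv 1 (curv x) s • principalNormal x s +
      (curv x s * tors x s) • binormal x s := by
  have hK := eventually_hasDerivAt_curv hx hκ.self_of_nhds 0
  have h0 : ∀ᶠ s in 𝓝 s₀, HasDerivAt (fun _ : ℝ => (0 : ℝ)) 0 s :=
    Filter.Eventually.of_forall fun s => hasDerivAt_const s _
  have h := eventually_deriv_frenet hx harc hκ (f := iteratedDeriv 2 x) h0 hK h0 (by
    filter_upwards [hκ] with s hs
    rw [iteratedDeriv_zero, curv_smul_principalNormal hs]
    simp)
  filter_upwards [h] with s hs
  rw [iteratedDeriv_succ, hs, iteratedDeriv_zero]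
  module

/-- The fourth derivative of a curve in its Frenet frame. -/
theorem eventually_iteratedDeriv_four (hx : ContDiff ℝ (⊤ : ℕ∞) x) (harc : ∀ s, ‖deriv x s‖ = 1)
    (hκ : ∀ᶠ s in 𝓝 s₀, 0 < curv x s) :
    ∀ᶠ s in 𝓝 s₀, iteratedDeriv 4 x s =
      (-3 * curv x s * iteratedDeriv 1 (curv x) s) • deriv x s +
      (iteratedDeriv 2 (curv x) s - curv x s ^ 3 - curv x s * tors x s ^ 2) •
        principalNormal x s +
      (2 * iteratedDeriv 1 (curv x) s * tors x s + curv x s * iteratedDeriv 1 (tors x) s) •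
        binormal x s := by
  have hK := eventually_hasDerivAt_curv hx hκ.self_of_nhds 0
  have hK₁ := eventually_hasDerivAt_curv hx hκ.self_of_nhds 1
  have hT := eventually_hasDerivAt_tors hx hκ.self_of_nhds 0
  simp only [iteratedDeriv_zero, zero_add] at hK hT
  have h := eventually_deriv_frenet hx harc hκ (f := iteratedDeriv 3 x)
    (hK.mono fun s hs => (hs.fun_pow 2).fun_neg) hK₁
    (hK.mp (hT.mono fun s h2 h1 => h1.fun_mul h2)) (eventually_iteratedDeriv_three hx harc hκ)
  filter_upwards [h] with s hs
  rw [iteratedDeriv_succ, hs]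
  push_cast
  module

/-- The fifth derivative of a curve in its Frenet frame. -/
theorem iteratedDeriv_five (hx : ContDiff ℝ (⊤ : ℕ∞) x) (harc : ∀ s, ‖deriv x s‖ = 1)
    (hκ : ∀ᶠ s in 𝓝 s₀, 0 < curv x s) :
    iteratedDeriv 5 x s₀ =
      (curv x s₀ ^ 4 + curv x s₀ ^ 2 * tors x s₀ ^ 2 - 3 * iteratedDeriv 1 (curv x) s₀ ^ 2 -
        4 * curv x s₀ * iteratedDeriv 2 (curv x) s₀) • deriv x s₀ +
      (iteratedDeriv 3 (curv x) s₀ - 6 * curv x s₀ ^ 2 * iteratedDeriv 1 (curv x) s₀ -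
        3 * iteratedDeriv 1 (curv x) s₀ * tors x s₀ ^ 2 -
        3 * curv x s₀ * tors x s₀ * iteratedDeriv 1 (tors x) s₀) • principalNormal x s₀ +
      (3 * iteratedDeriv 2 (curv x) s₀ * tors x s₀ +
        3 * iteratedDeriv 1 (curv x) s₀ * iteratedDeriv 1 (tors x) s₀ +
        curv x s₀ * iteratedDeriv 2 (tors x) s₀ - curv x s₀ ^ 3 * tors x s₀ -
        curv x s₀ * tors x s₀ ^ 3) • binormal x s₀ := by
  have hK := eventually_hasDerivAt_curv hx hκ.self_of_nhds 0
  have hK₁ := eventually_hasDerivAt_curv hx hκ.self_of_nhds 1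
  have hK₂ := eventually_hasDerivAt_curv hx hκ.self_of_nhds 2
  have hT := eventually_hasDerivAt_tors hx hκ.self_of_nhds 0
  have hT₁ := eventually_hasDerivAt_tors hx hκ.self_of_nhds 1
  simp only [iteratedDeriv_zero, zero_add] at hK hT
  have hall := hK.and (hK₁.and (hK₂.and (hT.and hT₁)))
  have h := eventually_deriv_frenet hx harc hκ (f := iteratedDeriv 4 x)
    (hall.mono fun s ⟨k, k₁, _, _, _⟩ => (k.const_mul (-3)).fun_mul k₁)
    (hall.mono fun s ⟨k, _, k₂, t, _⟩ =>
      (k₂.fun_sub (k.fun_pow 3)).fun_sub (k.fun_mul (t.fun_pow 2)))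
    (hall.mono fun s ⟨k, k₁, _, t, t₁⟩ => ((k₁.const_mul 2).fun_mul t).fun_add (k.fun_mul t₁))
    (eventually_iteratedDeriv_four hx harc hκ)
  rw [iteratedDeriv_succ, h.self_of_nhds]
  push_cast
  module

/-- Taylor expansion of the component of a curve in a fixed direction. -/
theorem isBigO_inner_taylor (hx : ContDiff ℝ (⊤ : ℕ∞) x) (s₀ : ℝ) (v : E3) :
    (fun ε => ⟪x (s₀ + ε) - x s₀, v⟫ - (ε * ⟪deriv x s₀, v⟫ +
      ε ^ 2 / 2 * ⟪iteratedDeriv 2 x s₀, v⟫ + ε ^ 3 / 6 * ⟪iteratedDeriv 3 x s₀, v⟫ +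
      ε ^ 4 / 24 * ⟪iteratedDeriv 4 x s₀, v⟫ + ε ^ 5 / 120 * ⟪iteratedDeriv 5 x s₀, v⟫))
      =O[𝓝[≠] (0 : ℝ)] fun ε => ε ^ 6 := by
  have h := taylor_isBigO_of_hasDerivAt (a := s₀) 5 (fun k => iteratedDeriv k x)
    (fun k _ => Filter.Eventually.of_forall (hasDerivAt_iteratedDeriv hx k))
    (hasDerivAt_iteratedDeriv hx 5 s₀).differentiableAt
  have hshift : Filter.Tendsto (fun ε : ℝ => s₀ + ε) (𝓝[≠] 0) (𝓝 s₀) := by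
    have : Continuous fun ε : ℝ => s₀ + ε := by fun_prop
    simpa using (this.tendsto 0).mono_left nhdsWithin_le_nhds
  have h2 := ((innerSL ℝ v).isBigO_comp _ _).trans (h.comp_tendsto hshift)
  refine (h2.congr_left fun ε => ?_).congr_right fun ε => ?_
  · simp only [Function.comp_apply, innerSL_apply_apply, add_sub_cancel_left,
      Finset.sum_range_succ, Finset.sum_range_zero, zero_add, inner_sub_right, inner_add_right,
      real_inner_smul_right, iteratedDeriv_zero, iteratedDeriv_one, Nat.factorial,
      real_inner_comm v]
    push_cast
    ring
  · simp

end Frenet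

/-- Jets of the rescaled coordinates of a curve in its Frenet frame. -/
theorem exists_frenet_jets {x : ℝ → E3} {s₀ : ℝ} (hx : ContDiff ℝ (⊤ : ℕ∞) x)
    (harc : ∀ s, ‖deriv x s‖ = 1) (hκ : ∀ᶠ s in 𝓝 s₀, 0 < curv x s)
    {K K1 K2 K3 T0 T1 T2 : ℝ}
    (hK : K = curv x s₀) (hK1 : K1 = deriv (curv x) s₀)
    (hK2 : K2 = iteratedDeriv 2 (curv x) s₀) (hK3 : K3 = iteratedDeriv 3 (curv x) s₀)
    (hT0 : T0 = tors x s₀) (hT1 : T1 = deriv (tors x) s₀)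
    (hT2 : T2 = iteratedDeriv 2 (tors x) s₀) :
    ∃ (b : OrthonormalBasis (Fin 3) ℝ E3) (U Y Z : ℝ → ℝ),
      (∀ ε, ε ≠ 0 → ⟪x (s₀ + ε) - x s₀, b 0⟫ = ε + ε ^ 2 * U ε) ∧
      (∀ ε, ε ≠ 0 → ⟪x (s₀ + ε) - x s₀, b 1⟫ = ε ^ 2 * (K / 2 + ε * Y ε)) ∧
      (∀ ε, ε ≠ 0 → ⟪x (s₀ + ε) - x s₀, b 2⟫ = ε ^ 3 * Z ε) ∧
      QuadJet U 0 (-K ^ 2 / 6) (-K * K1 / 8) ∧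
      QuadJet Y (K1 / 6) ((K2 - K ^ 3 - K * T0 ^ 2) / 24)
        ((K3 - 6 * K ^ 2 * K1 - 3 * K1 * T0 ^ 2 - 3 * K * T0 * T1) / 120) ∧
      QuadJet Z (K * T0 / 6) ((2 * K1 * T0 + K * T1) / 24)
        ((3 * K2 * T0 + 3 * K1 * T1 + K * T2 - K ^ 3 * T0 - K * T0 ^ 3) / 120) := by
  have hκ₀ := hκ.self_of_nhds
  obtain ⟨b, hb0, hb1, hb2⟩ := exists_orthonormalBasis_of_three (inner_deriv_self harc s₀)
    (inner_principalNormal_self hκ₀) (inner_binormal_self hx harc hκ₀)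
    (inner_principalNormal_deriv hx harc s₀) (inner_binormal_deriv x s₀)
    (inner_binormal_principalNormal x s₀)
  have hx₂ := (curv_smul_principalNormal hκ₀).symm
  have hx₃ := (eventually_iteratedDeriv_three hx harc hκ).self_of_nhds
  have hx₄ := (eventually_iteratedDeriv_four hx harc hκ).self_of_nhds
  have hx₅ := iteratedDeriv_five hx harc hκ
  simp only [iteratedDeriv_one, ← hb0, ← hb1, ← hb2, ← hK, ← hK1, ← hK2, ← hK3, ← hT0, ← hT1,
    ← hT2] at hx₂ hx₃ hx₄ hx₅
  have hinner : ∀ i j, ⟪b i, b j⟫ = if i = j then 1 else 0 :=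
    orthonormal_iff_ite.1 b.orthonormal
  have htaylor := fun i => isBigO_inner_taylor hx s₀ (b i)
  have ht0 := htaylor 0
  have ht1 := htaylor 1
  have ht2 := htaylor 2
  rw [← hb0, hx₂, hx₃, hx₄, hx₅] at ht0 ht1 ht2
  simp only [inner_add_left, real_inner_smul_left, hinner] at ht0 ht1 ht2
  simp at ht0 ht1 ht2
  refine ⟨b, fun ε => (⟪x (s₀ + ε) - x s₀, b 0⟫ - ε) / ε ^ 2,
    fun ε => (⟪x (s₀ + ε) - x s₀, b 1⟫ - ε ^ 2 * (K / 2)) / ε ^ 3,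
    fun ε => ⟪x (s₀ + ε) - x s₀, b 2⟫ / ε ^ 3, fun ε hε => ?_, fun ε hε => ?_, fun ε hε => ?_,
    quadJet_of_isBigO (F := fun ε => ⟪x (s₀ + ε) - x s₀, b 0⟫ - ε) 2 ?_ ?_,
    quadJet_of_isBigO (F := fun ε => ⟪x (s₀ + ε) - x s₀, b 1⟫ - ε ^ 2 * (K / 2)) 3 ?_ ?_,
    quadJet_of_isBigO (F := fun ε => ⟪x (s₀ + ε) - x s₀, b 2⟫) 3 ?_ ?_⟩
  · field_simp
    ring
  · field_simp
    ring
  · field_simp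
  · have h1 : (fun ε : ℝ => ε ^ 6) =O[𝓝[≠] (0 : ℝ)] fun ε => ε ^ (2 + 3) :=
      ((isBigO_refl (fun ε : ℝ => ε ^ 5) _).mul
        (isBigO_one_of_continuous continuous_id)).congr (fun ε => by simp [← pow_succ])
        (fun ε => by simp)
    have h2 := isBigO_const_mul_self ((K ^ 4 + K ^ 2 * T0 ^ 2 - 3 * K1 ^ 2 - 4 * K * K2) / 120)
      (fun ε : ℝ => ε ^ (2 + 3)) (𝓝[≠] 0)
    refine ((ht0.trans h1).add h2).congr_left fun ε => ?_
    ring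
  · filter_upwards [self_mem_nhdsWithin] with ε hε
    rw [mul_div_cancel₀ _ (pow_ne_zero 2 hε)]
  · refine ht1.congr_left fun ε => ?_
    ring
  · filter_upwards [self_mem_nhdsWithin] with ε hε
    rw [mul_div_cancel₀ _ (pow_ne_zero 3 hε)]
  · refine ht2.congr_left fun ε => ?_
    ring
  · filter_upwards [self_mem_nhdsWithin] with ε hε
    rw [mul_div_cancel₀ _ (pow_ne_zero 3 hε)]

theorem inner_div_norm_mul_norm_smul {a b : ℝ} (hab : 0 < a * b) (u v : E3) :
    ⟪a • u, b • v⟫ / (‖a • u‖ * ‖b • v‖) = ⟪u, v⟫ / (‖u‖ * ‖v‖) := by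
  rw [real_inner_smul_left, real_inner_smul_right, norm_smul, norm_smul, mul_mul_mul_comm,
    ← norm_mul, Real.norm_of_nonneg hab.le, ← mul_assoc, mul_div_mul_left _ _ (ne_of_gt hab)]

/-- The second-order jet of `e(w) / w` for the inverse `e` of the conformal arclength. -/
theorem exists_quadJet_conformal_inverse {x : ℝ → E3} {s₀ : ℝ} (hx : ContDiff ℝ (⊤ : ℕ∞) x)
    (hκ : 0 < curv x s₀) (hν : ∀ᶠ s in 𝓝 s₀, 0 < nu x s)
    {ω e : ℝ → ℝ} (hω : ∀ ε, ω ε = ∫ s in s₀..(s₀ + ε), Real.sqrt (nu x s))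
    (he0 : e 0 = 0) (hecont : ContinuousAt e 0) (hinv : ∀ᶠ w in 𝓝 (0 : ℝ), ω (e w) = w)
    {K K1 K2 K3 T0 T1 T2 M M1 M2 : ℝ}
    (hK : K = curv x s₀) (hK1 : K1 = deriv (curv x) s₀)
    (hK2 : K2 = iteratedDeriv 2 (curv x) s₀) (hK3 : K3 = iteratedDeriv 3 (curv x) s₀)
    (hT0 : T0 = tors x s₀) (hT1 : T1 = deriv (tors x) s₀)
    (hT2 : T2 = iteratedDeriv 2 (tors x) s₀) (hM : M = K1 ^ 2 + K ^ 2 * T0 ^ 2)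
    (hM1 : M1 = 2 * K1 * K2 + 2 * K * K1 * T0 ^ 2 + 2 * K ^ 2 * T0 * T1)
    (hM2 : M2 = 2 * K2 ^ 2 + 2 * K1 * K3 + 2 * K1 ^ 2 * T0 ^ 2 + 2 * K * K2 * T0 ^ 2 +
      8 * K * K1 * T0 * T1 + 2 * K ^ 2 * T1 ^ 2 + 2 * K ^ 2 * T0 * T2) :
    ∃ g, 0 < g ∧ g ^ 4 * M = 1 ∧ QuadJet (fun w => e w / w) g (-g ^ 6 * M1 / 8)
      ((3 / 8 * g ^ 11 * M1 ^ 2 - g ^ 7 * M2 / 4) / 6) := by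
  have k₀ := eventually_hasDerivAt_curv hx hκ 0
  have k₁ := eventually_hasDerivAt_curv hx hκ 1
  have k₂ := eventually_hasDerivAt_curv hx hκ 2
  have k₃ := (eventually_hasDerivAt_curv hx hκ 3).self_of_nhds.differentiableAt
  have t₀ := eventually_hasDerivAt_tors hx hκ 0
  have t₁ := eventually_hasDerivAt_tors hx hκ 1
  have t₂ := (eventually_hasDerivAt_tors hx hκ 2).self_of_nhds.differentiableAt
  simp only [iteratedDeriv_zero, iteratedDeriv_one, zero_add, Nat.reduceAdd] at k₀ k₁ k₂ k₃ t₀ t₁ t₂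
  subst hK hK1 hK2 hK3 hT0 hT1 hT2 hM hM1 hM2
  refine quadJet_localInverse_integral
    (M := fun s => deriv (curv x) s ^ 2 + curv x s ^ 2 * tors x s ^ 2)
    (M' := fun s => 2 * deriv (curv x) s * iteratedDeriv 2 (curv x) s +
      2 * curv x s * deriv (curv x) s * tors x s ^ 2 +
      2 * curv x s ^ 2 * tors x s * deriv (tors x) s)
    (M'' := fun s => 2 * iteratedDeriv 2 (curv x) s ^ 2 +
      2 * deriv (curv x) s * iteratedDeriv 3 (curv x) s +
      2 * deriv (curv x) s ^ 2 * tors x s ^ 2 +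
      2 * curv x s * iteratedDeriv 2 (curv x) s * tors x s ^ 2 +
      8 * curv x s * deriv (curv x) s * tors x s * deriv (tors x) s +
      2 * curv x s ^ 2 * deriv (tors x) s ^ 2 +
      2 * curv x s ^ 2 * tors x s * iteratedDeriv 2 (tors x) s)
    ?_ ?_ ?_ (hν.mono fun s hs => Real.sqrt_pos.1 hs) hω he0 hecont hinv
  · filter_upwards [k₀, k₁, t₀] with s k₀ k₁ t₀
    refine ((k₁.fun_pow 2).fun_add ((k₀.fun_pow 2).fun_mul (t₀.fun_pow 2))).congr_deriv ?_
    push_cast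
    ring
  · filter_upwards [k₀, k₁, k₂, t₀, t₁] with s k₀ k₁ k₂ t₀ t₁
    refine ((((k₁.const_mul 2).fun_mul k₂).fun_add
      (((k₀.const_mul 2).fun_mul k₁).fun_mul (t₀.fun_pow 2))).fun_add
      ((((k₀.fun_pow 2).const_mul 2).fun_mul t₀).fun_mul t₁)).congr_deriv ?_
    push_cast
    ring
  · have k₀ := k₀.self_of_nhds.differentiableAt
    have k₁ := k₁.self_of_nhds.differentiableAt
    have k₂ := k₂.self_of_nhds.differentiableAt
    have t₀ := t₀.self_of_nhds.differentiableAt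
    have t₁ := t₁.self_of_nhds.differentiableAt
    fun_prop

theorem rpow_five_halves_of_pow_mul_eq_one {g M : ℝ} (hg : 0 < g) (h : g ^ 4 * M = 1) :
    M ^ ((5 : ℝ) / 2) = (g ^ 10)⁻¹ := by
  have hM : M = g⁻¹ ^ (4 : ℝ) := by
    have : g⁻¹ ^ (4 : ℝ) = g⁻¹ ^ 4 := by exact_mod_cast Real.rpow_natCast g⁻¹ 4
    rw [this, inv_pow]
    exact eq_inv_of_mul_eq_one_right h
  rw [hM, ← Real.rpow_mul (inv_nonneg.2 hg.le), show (4 : ℝ) * (5 / 2) = (10 : ℕ) by norm_num,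
    Real.rpow_natCast, inv_pow]

theorem statement4 (x : ℝ → E3) (hx : ContDiff ℝ (⊤ : ℕ∞) x)
    (harc : ∀ s, ‖deriv x s‖ = 1) (s₀ : ℝ)
    (hκ : ∀ᶠ s in 𝓝 s₀, 0 < curv x s) (hν : ∀ᶠ s in 𝓝 s₀, 0 < nu x s)
    -- the conformal length function and its local inverse `e` at `0`
    (ω e : ℝ → ℝ) (hω : ∀ ε, ω ε = ∫ s in s₀..(s₀ + ε), Real.sqrt (nu x s))
    (he0 : e 0 = 0) (hecont : ContinuousAt e 0)
    (hinv : ∀ᶠ w in 𝓝 (0 : ℝ), ω (e w) = w)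
    -- abbreviations for κ, τ and their derivatives at s₀
    (K K1 K2 K3 T0 T1 T2 P : ℝ)
    (hK : K = curv x s₀) (hK1 : K1 = deriv (curv x) s₀)
    (hK2 : K2 = iteratedDeriv 2 (curv x) s₀) (hK3 : K3 = iteratedDeriv 3 (curv x) s₀)
    (hT0 : T0 = tors x s₀) (hT1 : T1 = deriv (tors x) s₀)
    (hT2 : T2 = iteratedDeriv 2 (tors x) s₀)
    (hP : P = (2 * K * T0 * K1 ^ 2 * (20 * K1 * T1 - 19 * T0 * K2) +
          2 * K ^ 3 * T0 ^ 3 * (5 * K1 * T1 - 4 * T0 * K2) +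
          K1 ^ 2 * (28 * T0 ^ 2 * K1 ^ 2 - 5 * K2 ^ 2 + 4 * K1 * K3) +
          K ^ 2 * (19 * T0 ^ 4 * K1 ^ 2 - 4 * K1 ^ 4 + 10 * K1 ^ 2 * T1 ^ 2 +
            2 * T0 * K1 * (2 * K1 * T2 - 15 * T1 * K2) +
            2 * T0 ^ 2 * (5 * K2 ^ 2 + 2 * K1 * K3)) +
          K ^ 4 * T0 ^ 2 * (6 * T0 ^ 4 - 8 * K1 ^ 2 - 5 * T1 ^ 2 + 4 * T0 * T2) -
          4 * K ^ 6 * T0 ^ 4) /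
        (192 * (K ^ 2 * T0 ^ 2 + K1 ^ 2) ^ ((5 : ℝ) / 2))) :
    (fun w : ℝ =>
        ⟪tLast (x (s₀ + e (-2 * w))) (x (s₀ + e (-w))) (x s₀),
            tMid (x (s₀ + e (-w))) (x s₀) (x (s₀ + e w))⟫ -
          (1 - w ^ 4 / 8 + P * w ^ 6))
      =O[𝓝[≠] (0 : ℝ)] fun w => w ^ 7 := by
  have hκ₀ := hκ.self_of_nhds
  obtain ⟨b, U, Y, Z, hXT, hXN, hXB, hU, hY, hZ⟩ :=
    exists_frenet_jets hx harc hκ hK hK1 hK2 hK3 hT0 hT1 hT2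
  obtain ⟨g, hg, hgM, hE⟩ := exists_quadJet_conformal_inverse hx hκ₀ hν hω he0 hecont hinv
    hK hK1 hK2 hK3 hT0 hT1 hT2 rfl rfl rfl
  rw [add_comm (K ^ 2 * T0 ^ 2), rpow_five_halves_of_pow_mul_eq_one hg hgM] at hP
  obtain ⟨q, hq⟩ : ∃ q : ℝ → E3,
      q = fun w => w • sphereInv (x (s₀ + w * (e w / w)) - x s₀) := ⟨_, rfl⟩
  have hmain := conformal_angle_expansion b (X := fun ε => x (s₀ + ε) - x s₀)
    (E := fun w => e w / w) (q := q) rfl rfl rfl hgM (hP.trans (by field_simp))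
    hXT hXN hXB hU hY hZ hE (fun w => by rw [hq])
  have hne : ∀ᶠ w in 𝓝[≠] (0 : ℝ), x (s₀ + e w) ≠ x s₀ := by
    have hU1 := (((QuadJet.const 1).add (QuadJet.id.mul hU)).comp_id_mul hE hg.ne').tendsto
    filter_upwards [self_mem_nhdsWithin, hE.tendsto.eventually_ne hg.ne',
      hU1.eventually_ne (show (1 + 0 * 0 : ℝ) ≠ 0 by norm_num)] with w hw h1 h2 heq
    have hw : w ≠ 0 := hw
    rw [mul_div_cancel₀ _ hw] at h2
    have hew : e w ≠ 0 := fun h => h1 (by rw [h, zero_div])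
    have h3 := hXT _ hew
    rw [heq, sub_self, inner_zero_left] at h3
    exact mul_ne_zero hew h2 (by linear_combination -h3)
  have hscale : ∀ k : ℝ, k ≠ 0 → ∀ᶠ w in 𝓝[≠] (0 : ℝ), x (s₀ + e (k * w)) ≠ x s₀ := by
    intro k hk
    have ht : Filter.Tendsto (fun w : ℝ => k * w) (𝓝[≠] 0) (𝓝[≠] 0) := by
      refine tendsto_nhdsWithin_iff.2 ⟨by simpa using tendsto_id_punctured.const_mul k, ?_⟩
      filter_upwards [self_mem_nhdsWithin] with w hw
      exact mul_ne_zero hk hw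
    exact ht.eventually hne
  have hqs : ∀ w, w ≠ 0 → q w = w • sphereInv (x (s₀ + e w) - x s₀) := by
    intro w hw
    rw [hq]
    simp only [mul_div_cancel₀ _ hw]
  refine hmain.congr' ?_ Filter.EventuallyEq.rfl
  filter_upwards [self_mem_nhdsWithin, hscale (-2) (by norm_num), hscale (-1) (by norm_num),
    hne] with w hw h1 h2 h3
  have hw : w ≠ 0 := hw
  rw [neg_one_mul] at h2
  rw [inner_tLast_tMid h1 h2 h3, neg_one_mul, one_mul, hqs _ hw, hqs _ (neg_ne_zero.2 hw),
    hqs (-2 * w) (mul_ne_zero (by norm_num) hw)]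
  have hab : 0 < 2 * w * (w / 2) := by
    have := pow_pos (abs_pos.2 hw) 2
    rw [sq_abs] at this
    linarith
  have hleft : ∀ u v : E3, (2 : ℝ) • (-w) • v - (-2 * w) • u = (2 * w) • (u - v) := fun u v => by
    module
  have hright : ∀ u v : E3, (1 / 2 : ℝ) • (w • u + (-w) • v) = (w / 2) • (u - v) := fun u v => by
    module
  rw [hleft, hright, inner_div_norm_mul_norm_smul hab]
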